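/- arXiv:1405.3232 — 2 statements merged into one kernel-verified Lean document; each statement's English description precedes it below -/
import Mathlib

section
/- The Leech lattice Λ admits an isometry of order 13 with no nonzero fixed vectors, i.e. there exists φ ∈ O(Λ) of order 13 with T_φ(Λ) = 0 (equivalently S_φ(Λ) = Λ). -/
open Module

/-- The invariant lattice `T_φ` of an isometry. -/
def fixSub {M : Type*} [AddCommGroup M] (φ : M ≃ₗ[ℤ] M) : Submodule ℤ M :=
  LinearMap.ker (φ.toLinearMap - LinearMap.id)

namespace LeechA

section Analysis
open MeasureTheory Complex

/-- Abstract Poisson summation on `ℤ^d`. -/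
theorem poisson {d : Type} [Fintype d] (f : (d → ℝ) → ℂ) (hf : Continuous f)
    (hint : Integrable f)
    (hu : ∀ R : ℝ, ∃ u : (d → ℤ) → ℝ, Summable u ∧ ∀ (x : d → ℤ) (t : d → ℝ), (∀ i, |t i| ≤ R) →
      ‖f (fun i => t i + x i)‖ ≤ u x)
    (g : (d → ℤ) → ℂ) (hg : Summable g)
    (hfg : ∀ k : d → ℤ, ∫ v : d → ℝ, UnitAddTorus.mFourier (-k) (fun i => (v i : UnitAddCircle)) * f v = g k) :
    ∑' x : d → ℤ, f (fun i => x i) = ∑' k, g k := by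
  classical
  let π : (d → ℝ) → UnitAddTorus d := fun v i => (v i : UnitAddCircle)
  have hq : IsOpenQuotientMap π := by
    have := IsOpenQuotientMap.piMap (ι := d) (A := fun _ => ℝ) (B := fun _ => UnitAddCircle)
      (f := fun _ (x : ℝ) => (x : UnitAddCircle)) (fun i => QuotientAddGroup.isOpenQuotientMap_mk)
    exact this
  let G : (d → ℝ) → ℂ := fun t => ∑' x : d → ℤ, f (fun i => t i + x i)
  have hGc : Continuous G := by
    rw [continuous_iff_continuousAt]
    intro t0
    obtain ⟨u, hus, hub⟩ := hu (‖t0‖ + 1)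
    have h1 : ContinuousOn G (Metric.ball t0 1) := by
      refine continuousOn_tsum (u := u) (fun x => ?_) hus (fun x t ht => hub x t (fun i => ?_))
      · apply Continuous.continuousOn
        fun_prop
      · have h2 : ‖t‖ ≤ ‖t0‖ + 1 := by
          have := norm_le_norm_add_norm_sub' t t0
          rw [Metric.mem_ball, dist_eq_norm] at ht
          linarith
        exact (norm_le_pi_norm t i).trans h2
    exact h1.continuousAt (Metric.ball_mem_nhds _ one_pos)
  have hGp : ∀ (t : d → ℝ) (m : d → ℤ), G (fun i => t i + m i) = G t := by
    intro t m
    simp only [G]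
    rw [← (Equiv.addLeft m).tsum_eq (fun x : d → ℤ => f (fun i => t i + x i))]
    congr 1; ext x; congr 1; ext i
    simp [add_assoc]
  have hGl : ∀ s t, π s = π t → G s = G t := by
    intro s t h
    have : ∀ i, ∃ m : ℤ, s i = t i + m := by
      intro i
      have h3 : (s i : UnitAddCircle) = (t i : UnitAddCircle) := congrFun h i
      rw [QuotientAddGroup.eq_iff_sub_mem, AddSubgroup.mem_zmultiples_iff] at h3
      obtain ⟨m, hm⟩ := h3
      refine ⟨m, ?_⟩
      simp at hm
      linarith
    choose m hm using this
    rw [← hGp t m]; congr 1; ext i; exact hm i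
  let F0 : UnitAddTorus d → ℂ := fun y => G (Function.surjInv hq.surjective y)
  have hF0 : ∀ t, F0 (π t) = G t := fun t => hGl _ _ (Function.surjInv_eq hq.surjective _)
  let F : C(UnitAddTorus d, ℂ) := ⟨F0, by
    rw [hq.isQuotientMap.continuous_iff]
    convert hGc using 1
    ext t; exact hF0 t⟩
  have hcoef : ∀ k, UnitAddTorus.mFourierCoeff F k = g k := by
    intro k
    rw [UnitAddTorus.mFourierCoeff_eq_integral F k 0, ← hfg k]
    let S : (d → ℤ) → Set (d → ℝ) := fun n => {x | ∀ i, x i ∈ Set.Ioc (n i : ℝ) (n i + 1)}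
    have hSm : ∀ n, MeasurableSet (S n) := by
      intro n
      have : S n = Set.univ.pi (fun i => Set.Ioc (n i : ℝ) (n i + 1)) := by ext; simp [S]
      rw [this]
      exact MeasurableSet.univ_pi (fun i => measurableSet_Ioc)
    have hSu : (⋃ n, S n) = Set.univ := by
      ext x
      simp only [Set.mem_iUnion, Set.mem_univ, iff_true]
      refine ⟨fun i => ⌈x i⌉ - 1, fun i => ?_⟩
      have h1 := Int.ceil_lt_add_one (x i)
      have h2 := Int.le_ceil (x i)
      simp only [Set.mem_Ioc]; push_cast
      constructor <;> linarith
    have hSd : Pairwise (Function.onFun Disjoint S) := by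
      intro m n hmn
      rw [Function.onFun, Set.disjoint_left]
      intro x hx hy
      apply hmn
      ext i
      have h1 := hx i
      have h2 := hy i
      simp only [Set.mem_Ioc] at h1 h2
      have h3 : (m i : ℝ) < n i + 1 := by linarith
      have h4 : (n i : ℝ) < m i + 1 := by linarith
      have h5 : m i < n i + 1 := by exact_mod_cast h3
      have h6 : n i < m i + 1 := by exact_mod_cast h4
      omega
    have hmc : Continuous (fun v : d → ℝ => UnitAddTorus.mFourier (-k) (π v)) :=
      (ContinuousMap.continuous _).comp hq.continuous
    have hmn : ∀ v, ‖UnitAddTorus.mFourier (-k) (π v)‖ ≤ 1 := by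
      intro v
      have := ContinuousMap.norm_coe_le_norm (UnitAddTorus.mFourier (-k)) (π v)
      rwa [UnitAddTorus.mFourier_norm] at this
    let h : (d → ℝ) → ℂ := fun v => UnitAddTorus.mFourier (-k) (π v) * f v
    have hhint : Integrable h := by
      refine hint.mono (hmc.mul hf).aestronglyMeasurable (ae_of_all _ fun v => ?_)
      simp only [h, norm_mul]
      exact mul_le_of_le_one_left (norm_nonneg _) (hmn v)
    have hsum := hasSum_integral_iUnion hSm hSd (f := h) (μ := volume) (by rw [hSu]; exact hhint.integrableOn)
    rw [hSu, setIntegral_univ] at hsum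
    change _ = ∫ v, h v
    rw [← hsum.tsum_eq]
    obtain ⟨u, hus, hub⟩ := hu 1
    have hπ : ∀ (t : d → ℝ) (n : d → ℤ), π (fun i => t i + n i) = π t := by
      intro t n; ext i
      simp [π]
    have hS0 : ∀ n, ∫ x in S n, h x = ∫ x in S 0, h (fun i => x i + n i) := by
      intro n
      have hmp := measurePreserving_add_right (volume : Measure (d → ℝ)) (fun i => (n i : ℝ))
      have := hmp.setIntegral_preimage_emb (measurableEmbedding_addRight _) h (S n)
      rw [← this]
      congr 2
      ext x
      simp only [S, Set.mem_preimage, Set.mem_ofPred_eq, Pi.add_apply, Set.mem_Ioc, Pi.zero_apply, Int.cast_zero]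
      refine forall_congr' fun i => ?_
      constructor <;> rintro ⟨h1, h2⟩ <;> constructor <;> linarith
    simp_rw [hS0]
    have hbd : ∀ n : d → ℤ, ∀ x ∈ S 0, ‖h (fun i => x i + n i)‖ ≤ u n := by
      intro n x hx
      have h1 : ‖f (fun i => x i + n i)‖ ≤ u n := hub n x (fun i => by
        have := hx i
        simp only [Pi.zero_apply, Int.cast_zero, Set.mem_Ioc] at this
        rw [abs_le]; constructor <;> linarith)
      simp only [h, norm_mul]
      exact (mul_le_of_le_one_left (norm_nonneg _) (hmn _)).trans h1
    have hS0eq : S 0 = Set.univ.pi (fun i => Set.Ioc (0 : ℝ) 1) := by ext; simp [S]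
    have hvol : (volume (S 0)) = 1 := by
      rw [hS0eq, volume_pi_pi]; simp
    have : IsFiniteMeasure (volume.restrict (S 0)) := ⟨by simp [hvol]⟩
    have hcn : ∀ n : d → ℤ, Continuous (fun x : d → ℝ => h (fun i => x i + n i)) := by
      intro n
      have : Continuous h := hmc.mul hf
      exact this.comp (by fun_prop)
    have hin : ∀ n : d → ℤ, IntegrableOn (fun x => h (fun i => x i + n i)) (S 0) := by
      intro n
      refine Integrable.mono' (integrable_const (u n)) (hcn n).aestronglyMeasurable ?_
      exact (ae_restrict_iff' (hSm 0)).2 (ae_of_all _ fun x hx => hbd n x hx)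
    have hcv := hasSum_integral_of_summable_integral_norm (μ := volume.restrict (S 0)) (F := fun (n : d → ℤ) (x : d → ℝ) => h (fun i => x i + n i)) hin (by
      refine Summable.of_nonneg_of_le (fun n => integral_nonneg fun _ => norm_nonneg _) (fun n => ?_) hus
      calc ∫ x in S 0, ‖h (fun i => x i + n i)‖ ≤ ∫ x in S 0, u n := by
            refine setIntegral_mono_on (hin n).norm (integrable_const _) (hSm 0) (fun x hx => hbd n x hx)
        _ = u n := by simp [hvol, Measure.real])
    rw [hcv.tsum_eq]
    have e1 : {x : d → ℝ | ∀ i, x i ∈ Set.Ioc ((0 : d → ℝ) i) ((0 : d → ℝ) i + 1)} = S 0 := by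
      ext; simp [S]
    rw [e1]
    refine setIntegral_congr_fun (hSm 0) fun x hx => ?_
    simp only [h]
    change _ • F0 (π x) = _
    rw [hF0, smul_eq_mul]
    simp only [G]
    rw [← tsum_mul_left]
    congr 1; ext n
    rw [hπ]
  have hfin := UnitAddTorus.hasSum_mFourier_series_apply_of_summable (f := F) (by
    simpa only [funext hcoef] using hg) (π 0)
  simp only [hcoef] at hfin
  have e2 : F (π 0) = ∑' x : d → ℤ, f (fun i => x i) := by
    change F0 (π 0) = _
    rw [hF0]; simp [G]
  rw [← e2, ← hfin.tsum_eq]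
  congr 1; ext k
  have : UnitAddTorus.mFourier k (π 0) = 1 := by
    simp [UnitAddTorus.mFourier, π]
  rw [this]; simp
theorem summable_gauss1 {β : ℝ} (hβ : 0 < β) :
    Summable fun x : ℤ => Real.exp (-β * (x : ℝ) ^ 2) := by
  have h := summable_pow_mul_jacobiTheta₂_term_bound 0 (T := β / Real.pi) (by positivity) 0
  refine h.congr fun x => ?_
  simp
  have : Real.pi ≠ 0 := Real.pi_ne_zero
  field_simp

theorem summable_gauss (n : ℕ) {β : ℝ} (hβ : 0 < β) :
    Summable fun x : Fin n → ℤ => Real.exp (-β * ∑ i, (x i : ℝ) ^ 2) := by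
  induction n with
  | zero => exact (hasSum_fintype _).summable
  | succ n ih =>
    rw [← (Fin.consEquiv (fun _ : Fin (n+1) => ℤ)).summable_iff]
    have := (summable_gauss1 hβ).mul_of_nonneg ih (fun _ => (Real.exp_pos _).le) (fun _ => (Real.exp_pos _).le)
    refine this.congr fun x => ?_
    simp only [Function.comp, Fin.consEquiv, Equiv.coe_fn_mk, Fin.sum_univ_succ, Fin.cons_zero, Fin.cons_succ]
    rw [← Real.exp_add]; congr 1; ring

/-- lower bound for a nondegenerate sum of squares -/
theorem exists_lower {n : ℕ} (M : Matrix (Fin n) (Fin n) ℝ) (hM : IsUnit M.det) :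
    ∃ c : ℝ, 0 < c ∧ ∀ v : Fin n → ℝ, c * ∑ i, v i ^ 2 ≤ ∑ i, (M.mulVec v i) ^ 2 := by
  let K : ℝ := ∑ i, ∑ j, (M⁻¹ i j) ^ 2
  have hK : 0 ≤ K := Finset.sum_nonneg fun i _ => Finset.sum_nonneg fun j _ => sq_nonneg _
  refine ⟨1 / (K + 1), by positivity, fun v => ?_⟩
  have hq : 0 ≤ ∑ i, (M.mulVec v i) ^ 2 := Finset.sum_nonneg fun i _ => sq_nonneg _
  have h1 : ∑ i, v i ^ 2 ≤ K * ∑ i, (M.mulVec v i) ^ 2 := by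
    have hv : v = M⁻¹.mulVec (M.mulVec v) := by
      rw [Matrix.mulVec_mulVec, Matrix.nonsing_inv_mul _ hM, Matrix.one_mulVec]
    rw [Finset.sum_mul]
    refine Finset.sum_le_sum fun i _ => ?_
    conv_lhs => rw [hv]
    simp only [Matrix.mulVec, dotProduct]
    exact Finset.sum_mul_sq_le_sq_mul_sq _ _ _
  rw [div_mul_eq_mul_div, one_mul, div_le_iff₀ (by positivity)]
  nlinarith

/-- the theta series -/
noncomputable def theta {n : ℕ} (q : (Fin n → ℤ) → ℤ) (z : ℂ) : ℂ :=
  ∑' x : Fin n → ℤ, cexp (Real.pi * I * z * (q x : ℂ))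

theorem norm_term (z : ℂ) (m : ℝ) : ‖cexp (Real.pi * I * z * (m : ℂ))‖ = Real.exp (-(Real.pi * z.im) * m) := by
  rw [Complex.norm_exp]; congr 1; simp

theorem theta_summable_norm {n : ℕ} (q : (Fin n → ℤ) → ℤ) {c : ℝ} (hc : 0 < c)
    (hq : ∀ x, c * ∑ i, (x i : ℝ) ^ 2 ≤ q x) {y : ℝ} (hy : 0 < y) :
    Summable fun x : Fin n → ℤ => Real.exp (-(Real.pi * y) * q x) := by
  refine Summable.of_nonneg_of_le (fun _ => (Real.exp_pos _).le) (fun x => ?_)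
    (summable_gauss n (β := Real.pi * y * c) (by positivity))
  apply Real.exp_le_exp.2
  have := mul_le_mul_of_nonneg_left (hq x) (show 0 ≤ Real.pi * y by positivity)
  linarith

theorem theta_summable {n : ℕ} (q : (Fin n → ℤ) → ℤ) {c : ℝ} (hc : 0 < c)
    (hq : ∀ x, c * ∑ i, (x i : ℝ) ^ 2 ≤ q x) {z : ℂ} (hz : 0 < z.im) :
    Summable fun x : Fin n → ℤ => cexp (Real.pi * I * z * (q x : ℂ)) := by
  refine Summable.of_norm ((theta_summable_norm q hc hq hz).congr fun x => ?_)
  have := norm_term z (q x : ℝ)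
  simp only [ofReal_intCast] at this
  rw [this]

theorem theta_inv (A : Matrix (Fin 24) (Fin 24) ℤ) (hA : IsUnit A.det)
    (M : Matrix (Fin 24) (Fin 24) ℝ) (hM : M.transpose * M = A.map (Int.cast : ℤ → ℝ))
    (q : (Fin 24 → ℤ) → ℤ) (hq : ∀ x, q x = x ⬝ᵥ A.mulVec x)
    {z : ℂ} (hz : 0 < z.im) : theta q z = (1 / z ^ 12) * theta q (-1 / z) := by
  have hz0 : z ≠ 0 := by rintro rfl; simp at hz
  have hdetA : ((A.map (Int.cast : ℤ → ℝ)).det) = (A.det : ℝ) := by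
    have := (Int.castRingHom ℝ).map_det A
    simpa using this.symm
  have hMdet : M.det ^ 2 = A.det := by
    rw [← hdetA, ← hM, Matrix.det_mul, Matrix.det_transpose]; ring
  have hAd : A.det = 1 := by
    rcases Int.isUnit_iff.1 hA with h | h
    · exact h
    · rw [h] at hMdet; norm_num at hMdet; nlinarith [sq_nonneg M.det]
  have hMabs : |M.det| = 1 := by
    rw [hAd] at hMdet
    have := sq_abs M.det
    rw [hMdet] at this
    simp at this
    have h0 := abs_nonneg M.det
    rcases this with h | h <;> simp [h] 
  have hMu : IsUnit M.det := by
    rw [isUnit_iff_ne_zero]; intro h; rw [h] at hMabs; simp at hMabs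
  -- quadratic form identity
  have hqM : ∀ x : Fin 24 → ℤ, (q x : ℝ) = ∑ i, (M.mulVec (fun i => (x i : ℝ)) i) ^ 2 := by
    intro x
    have h1 : ∑ i, (M.mulVec (fun i => (x i : ℝ)) i) ^ 2 = (fun i => (x i : ℝ)) ⬝ᵥ (A.map (Int.cast : ℤ → ℝ)).mulVec (fun i => (x i : ℝ)) := by
      rw [← hM, ← Matrix.mulVec_mulVec, Matrix.dotProduct_mulVec, Matrix.vecMul_transpose]
      simp [dotProduct, sq]
    rw [h1, hq]
    simp [dotProduct, Matrix.mulVec]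
  obtain ⟨c, hc, hcM⟩ := exists_lower M hMu
  have hqc : ∀ x : Fin 24 → ℤ, c * ∑ i, (x i : ℝ) ^ 2 ≤ q x := fun x => by rw [hqM]; exact hcM _
  set b : ℂ := -(Real.pi * I * z) with hb
  have hbre : 0 < b.re := by
    simp [hb]; positivity
  have hb0 : b ≠ 0 := by intro h; rw [h] at hbre; simp at hbre
  let f : (Fin 24 → ℝ) → ℂ := fun v => cexp (-b * ∑ i, ((M.mulVec v i : ℝ) : ℂ) ^ 2)
  have hMc : Continuous fun v : Fin 24 → ℝ => M.mulVec v := by fun_prop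
  have hfc : Continuous f := by
    simp only [f]
    refine Complex.continuous_exp.comp (continuous_const.mul (continuous_finsetSum _ fun i _ => ?_))
    exact (Complex.continuous_ofReal.comp ((continuous_apply i).comp hMc)).pow 2
  have hmp : MeasurePreserving (fun v : Fin 24 → ℝ => M.mulVec v) volume volume := by
    refine ⟨hMc.measurable, ?_⟩
    have := Real.map_matrix_volume_pi_eq_smul_volume_pi (M := M) hMu.ne_zero
    rw [abs_inv, hMabs] at this
    have h2 : (fun v : Fin 24 → ℝ => M.mulVec v) = ⇑(Matrix.toLin' M) := by ext v; simp
    rw [h2]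
    simpa using this
  have hemb : MeasurableEmbedding (fun v : Fin 24 → ℝ => M.mulVec v) := by
    refine (Topology.IsClosedEmbedding.measurableEmbedding ?_)
    have hinj : Function.Injective (Matrix.toLin' M) := by
      intro u v h
      have := congrArg M⁻¹.mulVec h
      simpa [Matrix.mulVec_mulVec, Matrix.nonsing_inv_mul _ hMu] using this
    exact (LinearMap.isClosedEmbedding_of_injective (LinearMap.ker_eq_bot.2 hinj))
  have hfint : Integrable f := by
    have h := GaussianFourier.integrable_cexp_neg_mul_sum_add (ι := Fin 24) hbre 0
    have := (hmp.integrable_comp_emb hemb (g := _)).2 h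
    refine this.congr (Filter.Eventually.of_forall fun v => ?_)
    simp [f]
  have hfn : ∀ v, ‖f v‖ = Real.exp (-(Real.pi * z.im) * ∑ i, (M.mulVec v i) ^ 2) := by
    intro v
    rw [← norm_term]; simp only [f, hb]; congr 2; push_cast; ring
  let g : (Fin 24 → ℤ) → ℂ := fun k => (Real.pi / b) ^ 12 *
    cexp ((∑ j, (-(2 * Real.pi * I) * ((M⁻¹.vecMul (fun i => (k i : ℝ)) j : ℝ) : ℂ)) ^ 2) / (4 * b))
  let e : (Fin 24 → ℤ) ≃ (Fin 24 → ℤ) :=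
    { toFun := A.mulVec, invFun := A⁻¹.mulVec
      left_inv := fun x => by rw [Matrix.mulVec_mulVec, Matrix.nonsing_inv_mul _ hA, Matrix.one_mulVec]
      right_inv := fun x => by rw [Matrix.mulVec_mulVec, Matrix.mul_nonsing_inv _ hA, Matrix.one_mulVec] }
  have hge : ∀ x, g (e x) = (1 / z ^ 12) * cexp (Real.pi * I * (-1 / z) * (q x : ℂ)) := by
    intro x
    have h1 : (M⁻¹.vecMul (fun i => ((e x) i : ℝ))) = M.mulVec (fun i => (x i : ℝ)) := by
      have h2 : (fun i => ((e x) i : ℝ)) = (A.map (Int.cast : ℤ → ℝ)).mulVec (fun i => (x i : ℝ)) := by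
        ext i; simp [e, Matrix.mulVec, dotProduct]
      rw [h2, ← hM, ← Matrix.mulVec_mulVec, ← Matrix.vecMul_transpose, Matrix.transpose_transpose, Matrix.vecMul_vecMul,
        Matrix.mul_nonsing_inv _ hMu, Matrix.vecMul_one]
    simp only [g]
    rw [h1]
    have h3 : (q x : ℂ) = ∑ i, ((M.mulVec (fun i => (x i : ℝ)) i : ℝ) : ℂ) ^ 2 := by
      have := hqM x
      have h4 : ((q x : ℝ) : ℂ) = ((∑ i, (M.mulVec (fun i => (x i : ℝ)) i) ^ 2 : ℝ) : ℂ) := by rw [this]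
      push_cast at h4
      exact h4
    rw [h3]
    have hpi : (Real.pi : ℂ) ≠ 0 := by exact_mod_cast Real.pi_ne_zero
    congr 1
    · rw [hb]
      have : (Real.pi : ℂ) / -(Real.pi * I * z) = I / z := by
        field_simp
        rw [I_sq]
      rw [this, div_pow]
      congr 1
      rw [show (12 : ℕ) = 4 * 3 by norm_num, pow_mul, I_pow_four, one_pow]
    · congr 1
      simp only [mul_pow, ← Finset.mul_sum, neg_pow_two, I_sq]
      rw [hb]
      field_simp
      ring_nf
      rw [I_sq]; ring
  have hz' : 0 < (-1 / z).im := by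
    rw [neg_div, Complex.neg_im, one_div, Complex.inv_im]
    have : 0 < Complex.normSq z := Complex.normSq_pos.2 hz0
    rw [neg_div, neg_neg]; positivity
  have hgs : Summable g := by
    rw [← e.summable_iff]
    refine ((theta_summable q hc hqc hz').mul_left (1 / z ^ 12)).congr fun x => ?_
    exact (hge x).symm
  have key := poisson f hfc hfint ?_ g hgs ?_
  · rw [theta, theta, ← tsum_mul_left]
    trans ∑' x : Fin 24 → ℤ, f (fun i => x i)
    · congr 1; ext x
      simp only [f]
      congr 1
      have h4 : ((q x : ℝ) : ℂ) = ((∑ i, (M.mulVec (fun i => (x i : ℝ)) i) ^ 2 : ℝ) : ℂ) := by rw [hqM x]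
      push_cast at h4
      rw [h4, hb]; ring
    · rw [key, ← e.tsum_eq]
      congr 1; ext x; exact hge x
  · intro R
    refine ⟨fun x => Real.exp (Real.pi * z.im * c * (24 * R ^ 2)) * Real.exp (-(Real.pi * z.im * c / 2) * ∑ i, (x i : ℝ) ^ 2),
      (summable_gauss 24 (by positivity)).mul_left _, fun x t ht => ?_⟩
    beta_reduce
    rw [hfn, ← Real.exp_add]
    apply Real.exp_le_exp.2
    have h1 := hcM (fun i => t i + x i)
    have h2 : ∑ i, ((x i : ℝ) ^ 2 / 2 - R ^ 2) ≤ ∑ i, (t i + x i) ^ 2 := by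
      refine Finset.sum_le_sum fun i _ => ?_
      have h3 : t i ^ 2 ≤ R ^ 2 := sq_le_sq' (by linarith [abs_le.1 (ht i)]) (by linarith [abs_le.1 (ht i)])
      nlinarith [sq_nonneg (2 * t i + x i)]
    rw [Finset.sum_sub_distrib, ← Finset.sum_div] at h2
    simp only [Finset.sum_const, Finset.card_univ, Fintype.card_fin, nsmul_eq_mul] at h2
    have h5 := mul_le_mul_of_nonneg_left h2 hc.le
    have h6 := mul_le_mul_of_nonneg_left (h5.trans h1) (show 0 ≤ Real.pi * z.im by positivity)
    push_cast at h6
    nlinarith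
  · intro k
    have h := GaussianFourier.integral_cexp_neg_mul_sum_add (ι := Fin 24) hbre
      (fun j => -(2 * Real.pi * I) * ((M⁻¹.vecMul (fun i => (k i : ℝ)) j : ℝ) : ℂ))
    simp only [g]
    have h12 : (Real.pi / b : ℂ) ^ 12 = (Real.pi / b) ^ ((Fintype.card (Fin 24) : ℂ) / 2) := by
      have : ((Fintype.card (Fin 24) : ℂ) / 2) = ((12 : ℕ) : ℂ) := by norm_num
      rw [this, Complex.cpow_natCast]
    rw [h12, ← h, ← hmp.integral_comp hemb (fun v : Fin 24 → ℝ => cexp (-b * ∑ i, (v i : ℂ) ^ 2 + ∑ i, -(2 * Real.pi * I) * ((M⁻¹.vecMul (fun i => (k i : ℝ)) i : ℝ) : ℂ) * (v i : ℂ)))]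
    congr 1; ext v
    have h5 : ∑ j, ((M⁻¹.vecMul (fun i => (k i : ℝ)) j : ℝ) : ℂ) * ((M.mulVec v j : ℝ) : ℂ) = ∑ i, (k i : ℂ) * (v i : ℂ) := by
      have : (M⁻¹.vecMul (fun i => (k i : ℝ))) ⬝ᵥ (M.mulVec v) = (fun i => (k i : ℝ)) ⬝ᵥ v := by
        rw [← Matrix.dotProduct_mulVec, Matrix.mulVec_mulVec, Matrix.nonsing_inv_mul _ hMu, Matrix.one_mulVec]
      simp only [dotProduct] at this
      exact_mod_cast congrArg (fun r : ℝ => (r : ℂ)) this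
    have h6 : UnitAddTorus.mFourier (-k) (fun i => (v i : UnitAddCircle)) = cexp (-(2 * Real.pi * I) * ∑ i, (k i : ℂ) * (v i : ℂ)) := by
      simp only [UnitAddTorus.mFourier, ContinuousMap.coe_mk, Pi.neg_apply]
      simp only [fourier_coe_apply]
      rw [← Complex.exp_sum, Finset.mul_sum]
      congr 1
      refine Finset.sum_congr rfl fun i _ => ?_
      push_cast; simp; ring
    rw [h6, ← h5]
    simp only [f, ← Complex.exp_add]
    congr 1
    simp only [mul_assoc, Finset.mul_sum]
    rw [add_comm]

end Analysis

section E
open UpperHalfPlane ModularForm ModularFormClass MatrixGroups EisensteinSeries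

noncomputable def ref12 : ModularForm 𝒮ℒ 12 :=
  (7/12 : ℂ) • ModularForm.mcast (by decide) (E₄.pow 3) + (5/12 : ℂ) • ModularForm.mcast (by decide) (E₆.pow 2)

theorem ref12_q :
    qExpansion 1 ref12 = (7/12 : ℂ) • (qExpansion 1 E₄ * qExpansion 1 E₄ * qExpansion 1 E₄) +
      (5/12 : ℂ) • (qExpansion 1 E₆ * qExpansion 1 E₆) := by
  have h1 := ModularForm.qExpansion_add one_pos one_mem_strictPeriods_SL
    ((7/12 : ℂ) • (ModularForm.mcast (by decide) (E₄.pow 3) : ModularForm 𝒮ℒ 12)) ((5/12 : ℂ) • (ModularForm.mcast (by decide) (E₆.pow 2) : ModularForm 𝒮ℒ 12))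
  have h2 := ModularForm.qExpansion_smul one_pos one_mem_strictPeriods_SL (7/12 : ℂ) (ModularForm.mcast (by decide) (E₄.pow 3) : ModularForm 𝒮ℒ 12)
  have h3 := ModularForm.qExpansion_smul one_pos one_mem_strictPeriods_SL (5/12 : ℂ) (ModularForm.mcast (by decide) (E₆.pow 2) : ModularForm 𝒮ℒ 12)
  have h4 : qExpansion 1 (ModularForm.mcast (by decide) (E₄.pow 3) : ModularForm 𝒮ℒ 12) = qExpansion 1 E₄ * qExpansion 1 E₄ * qExpansion 1 E₄ := by
    simp only [coe_mcast, ModularForm.qExpansion_pow one_pos one_mem_strictPeriods_SL]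
    ring
  have h5 : qExpansion 1 (ModularForm.mcast (by decide) (E₆.pow 2) : ModularForm 𝒮ℒ 12) = qExpansion 1 E₆ * qExpansion 1 E₆ := by
    simp only [coe_mcast, ModularForm.qExpansion_pow one_pos one_mem_strictPeriods_SL]
    ring
  rw [← h4, ← h5]
  exact h1.trans (congrArg₂ _ h2 h3)

theorem E4c (m : ℕ) : (qExpansion 1 E₄).coeff m = if m = 0 then 1 else 240 * ((ArithmeticFunction.sigma 3 m : ℕ) : ℂ) := by
  rw [EisensteinSeries.E_qExpansion_coeff _ ⟨2, rfl⟩ m, show bernoulli 4 = -1/30 by decide +kernel]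
  split_ifs <;> norm_num

theorem E6c (m : ℕ) : (qExpansion 1 E₆).coeff m = if m = 0 then 1 else -504 * ((ArithmeticFunction.sigma 5 m : ℕ) : ℂ) := by
  rw [EisensteinSeries.E_qExpansion_coeff _ ⟨3, rfl⟩ m, show bernoulli 6 = 1/42 by decide +kernel]
  split_ifs <;> norm_num

theorem ref12_coeffs : (qExpansion 1 ref12).coeff 0 = 1 ∧ (qExpansion 1 ref12).coeff 1 = 0 ∧ (qExpansion 1 ref12).coeff 2 = 196560
   ∧ (qExpansion 1 ref12).coeff 3 = 16773120 ∧ (qExpansion 1 ref12).coeff 4 = 398034000 := by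
  have s1 : ArithmeticFunction.sigma 3 1 = 1 := by decide +kernel
  have s2 : ArithmeticFunction.sigma 3 2 = 9 := by decide +kernel
  have s3 : ArithmeticFunction.sigma 3 3 = 28 := by decide +kernel
  have s4 : ArithmeticFunction.sigma 3 4 = 73 := by decide +kernel
  have t1 : ArithmeticFunction.sigma 5 1 = 1 := by decide +kernel
  have t2 : ArithmeticFunction.sigma 5 2 = 33 := by decide +kernel
  have t3 : ArithmeticFunction.sigma 5 3 = 244 := by decide +kernel
  have t4 : ArithmeticFunction.sigma 5 4 = 1057 := by decide +kernel
  rw [ref12_q]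
  refine ⟨?_, ?_, ?_, ?_, ?_⟩ <;>
  norm_num [PowerSeries.coeff_mul, Finset.Nat.antidiagonal_succ, E4c, E6c, -PowerSeries.coeff_zero_eq_constantCoeff, s1, s2, s3, s4, t1, t2, t3, t4]
end E

section T
open UpperHalfPlane ModularForm ModularFormClass MatrixGroups EisensteinSeries Complex

theorem fiber_finite {n : ℕ} (q : (Fin n → ℤ) → ℤ) {c : ℝ} (hc : 0 < c)
    (hq : ∀ x, c * ∑ i, (x i : ℝ) ^ 2 ≤ q x) (m : ℤ) : Finite {x // q x = m} := by
  have h := (theta_summable_norm q hc hq one_pos).comp_injective (i := fun x : {x // q x = m} => x.1) Subtype.val_injective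
  have h2 : Summable fun x : {x // q x = m} => Real.exp (-(Real.pi * 1) * m) := by
    refine h.congr ?_
    rintro ⟨x, hx⟩
    simp [Function.comp, hx]
  by_contra hf
  rw [not_finite_iff_infinite] at hf
  have := summable_const_iff (β := {x // q x = m}) (Real.exp (-(Real.pi * 1) * m)) |>.1 h2
  exact (Real.exp_pos _).ne' this

theorem theta_hasSum {n : ℕ} (q : (Fin n → ℤ) → ℤ) {c : ℝ} (hc : 0 < c)
    (hq : ∀ x, c * ∑ i, (x i : ℝ) ^ 2 ≤ q x) (hev : ∀ x, Even (q x)) (τ : ℍ) :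
    HasSum (fun m : ℕ => (Nat.card {x // q x = 2 * (m : ℤ)} : ℂ) • Function.Periodic.qParam 1 (τ : ℂ) ^ m) (theta q τ) := by
  have h := (theta_summable q hc hq τ.im_pos).hasSum
  let g : (Fin n → ℤ) → ℕ := fun x => (q x / 2).toNat
  rw [← (Equiv.sigmaFiberEquiv g).hasSum_iff] at h
  refine HasSum.sigma h fun m => ?_
  have hnn : ∀ x, 0 ≤ q x := fun x => by
    have : (0:ℝ) ≤ q x := le_trans (by positivity) (hq x)
    exact_mod_cast this
  have hg : ∀ x, g x = m ↔ q x = 2 * (m : ℤ) := fun x => by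
    have := hnn x
    obtain ⟨k, hk⟩ := hev x
    simp only [g]; omega
  have : Finite {x // q x = 2 * (m:ℤ)} := fiber_finite q hc hq _
  have : Finite {x // g x = m} := by simpa only [hg] using this
  have := Fintype.ofFinite {x // g x = m}
  have e : Nat.card {x // q x = 2 * (m:ℤ)} = Fintype.card {x // g x = m} := by
    rw [← Nat.card_eq_fintype_card]; simp only [hg]
  have h3 : ∀ x : {x // g x = m}, cexp (Real.pi * Complex.I * τ * (q x.1 : ℂ)) = Function.Periodic.qParam 1 (τ : ℂ) ^ m := by
    rintro ⟨x, hx⟩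
    rw [(hg x).1 hx, Function.Periodic.qParam, ← Complex.exp_nat_mul]
    congr 1; push_cast; ring
  have h4 := hasSum_fintype (fun x : {x // g x = m} => cexp (Real.pi * Complex.I * τ * (q x.1 : ℂ)))
  rw [show (fun c => ((fun x => cexp (Real.pi * Complex.I * τ * (q x : ℂ))) ∘ (Equiv.sigmaFiberEquiv g)) ⟨m, c⟩) = (fun x : {x // g x = m} => cexp (Real.pi * Complex.I * τ * (q x.1 : ℂ))) from rfl]
  convert h4 using 1
  rw [Finset.sum_congr rfl (fun x _ => h3 x), Finset.sum_const, Finset.card_univ, e]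
  simp

theorem theta_diff {n : ℕ} (q : (Fin n → ℤ) → ℤ) {c : ℝ} (hc : 0 < c)
    (hq : ∀ x, c * ∑ i, (x i : ℝ) ^ 2 ≤ q x) : DifferentiableOn ℂ (theta q) {z | 0 < z.im} := by
  intro z hz
  simp only [Set.mem_ofPred_eq] at hz
  have ho : IsOpen {w : ℂ | z.im / 2 < w.im} := isOpen_lt continuous_const Complex.continuous_im
  have h : DifferentiableOn ℂ (theta q) {w | z.im / 2 < w.im} := by
    refine differentiableOn_tsum_of_summable_norm (theta_summable_norm q hc hq (half_pos hz)) ?_ ho ?_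
    · intro x; fun_prop
    · intro x w hw
      have hnn : (0:ℝ) ≤ q x := le_trans (by positivity) (hq x)
      have := norm_term w (q x)
      push_cast at this
      rw [this]
      simp only [Set.mem_ofPred_eq] at hw
      apply Real.exp_le_exp.2
      have := mul_nonneg Real.pi_pos.le hnn
      nlinarith
  have hm : z ∈ {w : ℂ | z.im / 2 < w.im} := by simp only [Set.mem_ofPred_eq]; linarith
  exact (h.differentiableAt (ho.mem_nhds hm)).differentiableWithinAt

theorem theta_slash {n : ℕ} (q : (Fin n → ℤ) → ℤ) 
    (hev : ∀ x, Even (q x)) (hinv : ∀ z : ℂ, 0 < z.im → theta q z = (1 / z ^ 12) * theta q (-1 / z)) (γ : SL(2, ℤ)) :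
    (fun τ : ℍ => theta q τ) ∣[(12:ℤ)] γ = fun τ : ℍ => theta q τ := by
  apply SlashInvariantForm.slash_action_generators_SL2Z
  · funext τ
    rw [SlashInvariantForm.slash_S_apply]
    have := hinv τ τ.im_pos
    rw [this]
    change theta q ((-(τ:ℂ))⁻¹) * _ = _
    rw [show (-(τ:ℂ))⁻¹ = -1 / (τ:ℂ) by rw [neg_inv.symm]; field_simp]
    rw [zpow_neg]
    norm_cast
    rw [one_div, mul_comm]
  · funext τ
    rw [SL_slash_apply, modular_T_smul]
    simp [theta, denom, ModularGroup.coe_T]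
    refine tsum_congr fun x => ?_
    obtain ⟨k, hk⟩ := hev x
    rw [hk]
    rw [Complex.exp_eq_exp_iff_exists_int]
    refine ⟨k, ?_⟩
    push_cast; ring

noncomputable def thetaMF {n : ℕ} (q : (Fin n → ℤ) → ℤ) {c : ℝ} (hc : 0 < c)
    (hq : ∀ x, c * ∑ i, (x i : ℝ) ^ 2 ≤ q x) (hev : ∀ x, Even (q x))
    (hinv : ∀ z : ℂ, 0 < z.im → theta q z = (1 / z ^ 12) * theta q (-1 / z)) : ModularForm 𝒮ℒ 12 where
  toFun := fun τ : ℍ => theta q τ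
  slash_action_eq' := by
    rintro _ ⟨γ, rfl⟩
    exact theta_slash q hev hinv γ
  holo' := by
    rw [UpperHalfPlane.mdifferentiable_iff]
    refine (theta_diff q hc hq).congr fun z hz => ?_
    simp [ofComplex_apply_of_im_pos hz]
  bdd_at_cusps' := by
    intro a ha
    rw [OnePoint.isBoundedAt_iff_forall_SL2Z ha]
    intro γ _
    rw [theta_slash q hev hinv γ]
    exact isBoundedAtImInfty_of_hasSum_qExpansion one_pos (theta_hasSum q hc hq hev)

theorem counts {n : ℕ} (q : (Fin n → ℤ) → ℤ) {c : ℝ} (hc : 0 < c)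
    (hq : ∀ x, c * ∑ i, (x i : ℝ) ^ 2 ≤ q x) (hev : ∀ x, Even (q x))
    (hinv : ∀ z : ℂ, 0 < z.im → theta q z = (1 / z ^ 12) * theta q (-1 / z))
    (h0 : q 0 = 0) (h00 : ∀ x, q x = 0 → x = 0) (h2 : ∀ x, q x ≠ 2) :
    Nat.card {x // q x = 4} = 196560 ∧ Nat.card {x // q x = 6} = 16773120 ∧ Nat.card {x // q x = 8} = 398034000 := by
  have key : ∀ m : ℕ, (Nat.card {x // q x = 2 * (m : ℤ)} : ℂ) = (qExpansion 1 (thetaMF q hc hq hev hinv)).coeff m :=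
    ModularFormClass.qExpansion_coeff_unique one_pos one_mem_strictPeriods_SL
      (f := thetaMF q hc hq hev hinv) (theta_hasSum q hc hq hev)
  obtain ⟨r0, r1, r2, r3, r4⟩ := ref12_coeffs
  have c0 : Nat.card {x // q x = 2 * ((0:ℕ) : ℤ)} = 1 := by
    rw [Nat.card_eq_one_iff_unique]
    refine ⟨⟨fun a b => ?_⟩, ⟨⟨0, by simpa using h0⟩⟩⟩
    apply Subtype.ext
    exact (h00 a.1 (by simpa using a.2)).trans (h00 b.1 (by simpa using b.2)).symm
  have c1 : Nat.card {x // q x = 2 * ((1:ℕ) : ℤ)} = 0 := by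
    have : IsEmpty {x // q x = 2 * ((1:ℕ) : ℤ)} := ⟨fun a => h2 a.1 (by simpa using a.2)⟩
    exact Nat.card_of_isEmpty
  have heq : thetaMF q hc hq hev hinv - ref12 = 0 := by
    apply ModularForm.sturm_bound_levelOne
    have hs := ModularForm.qExpansion_sub one_pos one_mem_strictPeriods_SL (thetaMF q hc hq hev hinv) ref12
    have : qExpansion 1 (thetaMF q hc hq hev hinv - ref12 : ModularForm 𝒮ℒ 12) = qExpansion 1 (thetaMF q hc hq hev hinv) - qExpansion 1 ref12 := hs
    rw [this]
    refine lt_of_lt_of_le (b := ((2:ℕ) : ℕ∞)) (by exact_mod_cast (by decide : Int.toNat 12 / 12 < 2)) (PowerSeries.nat_le_order _ _ ?_)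
    intro i hi
    rw [map_sub, ← key i]
    interval_cases i
    · rw [c0, r0]; simp
    · rw [c1, r1]; simp
  have heq' := sub_eq_zero.1 heq
  refine ⟨?_, ?_, ?_⟩
  · have := key 2; rw [heq', r2] at this; norm_num at this; exact_mod_cast this
  · have := key 3; rw [heq', r3] at this; norm_num at this; exact_mod_cast this
  · have := key 4; rw [heq', r4] at this; norm_num at this; exact_mod_cast this
end T

structure IsLeech {Λ : Type*} [AddCommGroup Λ] (B : Λ →ₗ[ℤ] Λ →ₗ[ℤ] ℤ) : Prop where
  symm : ∀ x y, B x y = B y x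
  even : ∀ x, Even (B x x)
  pos : ∀ x, x ≠ 0 → 0 < B x x
  unimod : Function.Bijective B
  noroot : ∀ x, B x x ≠ 2

theorem psd_of_int {n : ℕ} (A : Matrix (Fin n) (Fin n) ℤ) (h : ∀ x : Fin n → ℤ, 0 ≤ dotProduct x (A.mulVec x))
    (v : Fin n → ℝ) : 0 ≤ dotProduct v ((A.map (Int.cast : ℤ → ℝ)).mulVec v) := by
  have hd : DenseRange (fun w : Fin n → ℚ => fun i => ((w i : ℚ) : ℝ)) :=
    DenseRange.piMap (fun _ => Rat.denseRange_cast)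
  refine hd.induction_on (p := fun v => 0 ≤ dotProduct v ((A.map (Int.cast : ℤ → ℝ)).mulVec v)) v ?_ ?_
  · apply isClosed_le continuous_const
    simp only [dotProduct, Matrix.mulVec]
    fun_prop
  · intro w
    -- clear denominators
    let N : ℕ := ∏ i, (w i).den
    have hN : 0 < N := Finset.prod_pos fun i _ => (w i).den_pos
    have hx : ∀ i, ∃ z : ℤ, ((N : ℝ) * (w i : ℝ)) = z := fun i => by
      obtain ⟨k, hk⟩ := Finset.dvd_prod_of_mem (fun i => (w i).den) (Finset.mem_univ i)
      refine ⟨(w i).num * k, ?_⟩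
      have h1 : ((w i).den : ℝ) * (w i : ℝ) = (w i).num := by
        exact_mod_cast Rat.den_mul_eq_num (w i)
      simp only [N, hk]
      push_cast
      rw [← h1]; ring
    choose z hz using hx
    have h1 := h z
    have h2 : ((dotProduct z (A.mulVec z) : ℤ) : ℝ) = (N:ℝ)^2 * dotProduct (fun i => (w i : ℝ)) ((A.map (Int.cast : ℤ → ℝ)).mulVec (fun i => (w i : ℝ))) := by
      simp only [dotProduct, Matrix.mulVec, Matrix.map_apply]
      push_cast
      simp only [← hz, Finset.mul_sum]
      refine Finset.sum_congr rfl fun i _ => Finset.sum_congr rfl fun j _ => ?_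
      ring
    have h3 : (0:ℝ) ≤ (N:ℝ)^2 * dotProduct (fun i => (w i : ℝ)) ((A.map (Int.cast : ℤ → ℝ)).mulVec (fun i => (w i : ℝ))) := by
      rw [← h2]; exact_mod_cast h1
    have hN' : (0:ℝ) < (N:ℝ)^2 := by positivity
    exact nonneg_of_mul_nonneg_right h3 hN'

open scoped ComplexOrder MatrixOrder Matrix.Norms.L2Operator in
theorem lattice_counts {Λ : Type*} [AddCommGroup Λ] [Module.Free ℤ Λ] [Module.Finite ℤ Λ]
    {B : Λ →ₗ[ℤ] Λ →ₗ[ℤ] ℤ} (hB : IsLeech B) (hrank : finrank ℤ Λ = 24) :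
    Nat.card {x // B x x = 4} = 196560 ∧ Nat.card {x // B x x = 6} = 16773120 ∧ Nat.card {x // B x x = 8} = 398034000 := by
  let b : Basis (Fin 24) ℤ Λ := Module.finBasisOfFinrankEq ℤ Λ hrank
  let A : Matrix (Fin 24) (Fin 24) ℤ := fun i j => B (b i) (b j)
  have hA : IsUnit A.det := by
    choose y hy using fun j : Fin 24 => hB.unimod.2 (b.coord j)
    have : (Matrix.of fun j k => b.repr (y j) k) * A = 1 := by
      ext j i
      have h1 : B (y j) (b i) = if i = j then 1 else 0 := by
        rw [hy]; simp [Finsupp.single_apply]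
      rw [← b.sum_repr (y j)] at h1
      simp only [map_sum, map_smul, LinearMap.sum_apply, LinearMap.smul_apply, smul_eq_mul] at h1
      rw [Matrix.mul_apply, Matrix.one_apply]
      refine Eq.trans h1 ?_
      simp only [eq_comm]
    exact Matrix.isUnit_det_of_left_inverse this
  let q : (Fin 24 → ℤ) → ℤ := fun x => B (b.equivFun.symm x) (b.equivFun.symm x)
  have hqA : ∀ x, q x = dotProduct x (A.mulVec x) := by
    intro x
    simp only [q, A, Basis.equivFun_symm_apply, dotProduct, Matrix.mulVec, map_sum, map_smul, LinearMap.sum_apply, LinearMap.smul_apply, smul_eq_mul, Finset.mul_sum]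
    rw [Finset.sum_comm]
    refine Finset.sum_congr rfl fun i _ => Finset.sum_congr rfl fun j _ => ?_
    ring
  have hnn : ∀ x, 0 ≤ B x x := fun x => by
    by_cases h : x = 0
    · simp [h]
    · exact (hB.pos x h).le
  have hpsd : (A.map (Int.cast : ℤ → ℝ)).PosSemidef := by
    apply Matrix.PosSemidef.of_dotProduct_mulVec_nonneg
    · ext i j
      change ((B (b j) (b i) : ℤ) : ℝ) = ((B (b i) (b j) : ℤ) : ℝ)
      rw [hB.symm]
    · intro v
      simpa using psd_of_int A (fun x => by rw [← hqA]; exact hnn _) v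
  obtain ⟨M, hM⟩ := CStarAlgebra.nonneg_iff_eq_star_mul_self.mp hpsd.nonneg
  have hM' : M.transpose * M = A.map (Int.cast : ℤ → ℝ) := by
    rw [hM, Matrix.star_eq_conjTranspose, Matrix.conjTranspose_eq_transpose_of_trivial]
  have hMu : IsUnit M.det := by
    have h1 : IsUnit (M.transpose * M).det := by
      rw [hM']
      have := hA.map (Int.castRingHom ℝ)
      rwa [RingHom.map_det] at this
    rw [Matrix.det_mul] at h1
    exact isUnit_of_mul_isUnit_right h1
  obtain ⟨c, hc, hlow⟩ := exists_lower M hMu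
  have hlow' : ∀ x, c * ∑ i, (x i : ℝ) ^ 2 ≤ q x := by
    intro x
    refine (hlow (fun i => (x i : ℝ))).trans (le_of_eq ?_)
    have h1 : ∑ i, (M.mulVec (fun i => (x i : ℝ)) i)^2 = dotProduct (fun i => (x i : ℝ)) ((M.transpose * M).mulVec (fun i => (x i : ℝ))) := by
      rw [← Matrix.mulVec_mulVec, Matrix.dotProduct_mulVec, Matrix.vecMul_transpose]
      simp only [dotProduct, sq]
    rw [h1, hM', hqA]
    simp [dotProduct, Matrix.mulVec]
  have := counts q hc hlow' (fun x => hB.even _) (fun z hz => theta_inv A hA M hM' q hqA hz) (by simp [q])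
    (fun x hx => by
      by_contra hne
      have h1 : b.equivFun.symm x ≠ 0 := fun h => hne (b.equivFun.symm.injective (h.trans (map_zero _).symm))
      exact (hB.pos _ h1).ne' hx) (fun x => hB.noroot _)
  have e : ∀ m : ℤ, Nat.card {x // q x = m} = Nat.card {x // B x x = m} := fun m =>
    Nat.card_congr (b.equivFun.symm.toEquiv.subtypeEquiv (fun x => Iff.rfl))
  simpa only [e] using this

section Frame
variable {Λ : Type*} [AddCommGroup Λ] {B : Λ →ₗ[ℤ] Λ →ₗ[ℤ] ℤ}

theorem IsLeech.ge4 (hB : IsLeech B) {x : Λ} (hx : x ≠ 0) : 4 ≤ B x x := by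
  have h1 := hB.pos x hx
  obtain ⟨k, hk⟩ := hB.even x
  have := hB.noroot x
  omega

theorem IsLeech.congr_two (hB : IsLeech B) {x y u : Λ} (hu : x - y = (2:ℤ) • u) (hx : B x x ≤ 8) (hy : B y y ≤ 8)
    (h1 : x ≠ y) (h2 : x ≠ -y) : B x x = 8 ∧ B y y = 8 ∧ B x y = 0 := by
  have hu0 : u ≠ 0 := by
    rintro rfl; rw [smul_zero, sub_eq_zero] at hu; exact h1 hu
  have hv : x + y = (2:ℤ) • (u + y) := by
    rw [smul_add, ← hu, two_smul]; abel
  have hv0 : u + y ≠ 0 := by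
    intro h; rw [h, smul_zero] at hv; exact h2 (eq_neg_of_add_eq_zero_left hv)
  have e1 : B (x - y) (x - y) = 4 * B u u := by
    rw [hu]; simp; ring
  have e2 : B (x + y) (x + y) = 4 * B (u + y) (u + y) := by
    rw [hv]; simp only [map_smul, LinearMap.smul_apply, smul_eq_mul]; ring
  have f1 := hB.ge4 hu0
  have f2 := hB.ge4 hv0
  have s := hB.symm x y
  simp only [map_sub, map_add, LinearMap.sub_apply, LinearMap.add_apply] at e1 e2
  simp only [map_add, LinearMap.add_apply] at f2
  refine ⟨?_, ?_, ?_⟩ <;> linarith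

open Classical in
theorem frame [Module.Free ℤ Λ] [Module.Finite ℤ Λ] (hB : IsLeech B) (hrank : finrank ℤ Λ = 24) :
    ∃ f : Fin 24 → Λ, (∀ i, B (f i) (f i) = 8) ∧ (∀ i j, i ≠ j → B (f i) (f j) = 0) ∧
      ∀ i j, ∃ y, f i - f j = (2:ℤ) • y := by
  obtain ⟨c4, c6, c8⟩ := lattice_counts hB hrank
  let b : Basis (Fin 24) ℤ Λ := Module.finBasisOfFinrankEq ℤ Λ hrank
  let π : Λ → (Fin 24 → ZMod 2) := fun x i => (b.repr x i : ZMod 2)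
  have hπ : ∀ x y, π x = π y → ∃ u, x - y = (2:ℤ) • u := by
    intro x y h
    have : ∀ i, ∃ k : ℤ, b.repr x i - b.repr y i = 2 * k := fun i => by
      have h1 := congrFun h i
      simp only [π] at h1
      have h2 := (ZMod.intCast_eq_intCast_iff_dvd_sub _ _ 2).1 h1.symm
      exact h2
    choose k hk using this
    refine ⟨∑ i, k i • b i, ?_⟩
    apply b.repr.injective
    ext i
    simp [hk, Finsupp.single_apply]
  have key : ∀ x y, π x = π y → B x x ≤ 8 → B y y ≤ 8 → x ≠ y → x ≠ -y → B x x = 8 ∧ B y y = 8 ∧ B x y = 0 := by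
    intro x y h hx hy h1 h2
    obtain ⟨u, hu⟩ := hπ x y h
    exact hB.congr_two hu hx hy h1 h2
  have hfin : ∀ m N, Nat.card {x // B x x = m} = N → N ≠ 0 → ∃ V : Finset Λ, V.card = N ∧ ∀ x, x ∈ V ↔ B x x = m := by
    intro m N h hN
    have : Finite {x // B x x = m} := Nat.finite_of_card_ne_zero (h ▸ hN)
    have := Fintype.ofFinite {x // B x x = m}
    refine ⟨Finset.univ.map ⟨fun x : {x // B x x = m} => x.1, Subtype.val_injective⟩, ?_, ?_⟩
    · rw [Finset.card_map, Finset.card_univ, ← Nat.card_eq_fintype_card, h]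
    · intro x; simp
  obtain ⟨V4, n4, m4⟩ := hfin 4 _ c4 (by norm_num)
  obtain ⟨V6, n6, m6⟩ := hfin 6 _ c6 (by norm_num)
  obtain ⟨V8, n8, m8⟩ := hfin 8 _ c8 (by norm_num)
  have neg8 : ∀ x y : Λ, x = y ∨ x = -y → B x x = B y y := by
    rintro x y (rfl | rfl) <;> simp
  have small : ∀ (V : Finset Λ) (m : ℤ), m < 8 → (∀ x, x ∈ V ↔ B x x = m) → V.card ≤ 2 * (V.image π).card := by
    intro V m hm hV
    apply Finset.card_le_mul_card_image
    intro a ha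
    obtain ⟨x, hx, rfl⟩ := Finset.mem_image.1 ha
    refine (Finset.card_le_card (t := {x, -x}) ?_).trans Finset.card_le_two
    intro y hy
    rw [Finset.mem_filter, hV] at hy
    rw [hV] at hx
    by_contra hne
    simp only [Finset.mem_insert, Finset.mem_singleton, not_or] at hne
    have := (key y x hy.2 (by omega) (by omega) hne.1 hne.2).1
    omega
  have big : ∃ a, 47 < (V8.filter (fun x => π x = a)).card := by
    by_contra hcon
    push Not at hcon
    have s4 := small V4 4 (by norm_num) m4
    have s6 := small V6 6 (by norm_num) m6
    have s8 := Finset.card_le_mul_card_image (f := π) V8 47 (fun a _ => hcon a)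
    have dis : ∀ (V W : Finset Λ) (m n : ℤ), m ≤ 8 → n < 8 → m ≠ n → (∀ x, x ∈ V → B x x = m) → (∀ x, x ∈ W → B x x = n) →
        Disjoint (V.image π) (W.image π) := by
      intro V W m n hm hn hmn hV hW
      rw [Finset.disjoint_left]
      intro a ha hb
      obtain ⟨x, hx, rfl⟩ := Finset.mem_image.1 ha
      obtain ⟨y, hy, hxy⟩ := Finset.mem_image.1 hb
      have h1 := hV x hx
      have h2 := hW y hy
      by_cases h : y = x ∨ y = -x
      · have := neg8 _ _ h; omega
      · push Not at h
        have := (key y x hxy (by omega) (by omega) h.1 h.2).1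
        omega
    have d1 := dis V8 V6 8 6 (by norm_num) (by norm_num) (by norm_num) (fun x => (m8 x).1) (fun x => (m6 x).1)
    have d2 := dis V8 V4 8 4 (by norm_num) (by norm_num) (by norm_num) (fun x => (m8 x).1) (fun x => (m4 x).1)
    have d3 := dis V6 V4 6 4 (by norm_num) (by norm_num) (by norm_num) (fun x => (m6 x).1) (fun x => (m4 x).1)
    have hle := Finset.card_le_univ (((V8.image π) ∪ (V6.image π)) ∪ (V4.image π))
    rw [Finset.card_union_of_disjoint (Finset.disjoint_union_left.2 ⟨d2, d3⟩), Finset.card_union_of_disjoint d1] at hle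
    have hcard : Fintype.card (Fin 24 → ZMod 2) = 16777216 := by simp
    rw [hcard] at hle
    omega
  obtain ⟨a, ha⟩ := big
  set F := V8.filter (fun x => π x = a) with hF
  let p : Λ → Finset Λ := fun x => {x, -x}
  have hp : F.card ≤ 2 * (F.image p).card := by
    apply Finset.card_le_mul_card_image
    intro s hs
    obtain ⟨x, hx, rfl⟩ := Finset.mem_image.1 hs
    refine (Finset.card_le_card (t := {x, -x}) ?_).trans Finset.card_le_two
    intro y hy
    rw [Finset.mem_filter] at hy
    have : y ∈ p y := by simp [p]
    rw [hy.2] at this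
    exact this
  have h24 : 24 ≤ (F.image p).card := by omega
  obtain ⟨t, ht, htc⟩ := Finset.exists_subset_card_eq h24
  have e : Fin 24 ≃ t := (Finset.equivFinOfCardEq htc).symm
  have hex : ∀ i, ∃ x ∈ F, p x = (e i).1 := fun i => Finset.mem_image.1 (ht (e i).2)
  choose f hf hpf using hex
  have hf' : ∀ i, B (f i) (f i) = 8 ∧ π (f i) = a := fun i => by
    have := hf i
    rw [hF, Finset.mem_filter, m8] at this
    exact this
  refine ⟨f, fun i => (hf' i).1, ?_, ?_⟩
  · intro i j hij
    have hpne : p (f i) ≠ p (f j) := by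
      rw [hpf, hpf]
      intro h
      exact hij (e.injective (Subtype.ext h))
    refine (key (f i) (f j) ((hf' i).2.trans (hf' j).2.symm) (hf' i).1.le (hf' j).1.le ?_ ?_).2.2
    · intro h; exact hpne (by rw [h])
    · intro h; apply hpne; rw [h]; simp only [p, neg_neg]; exact Finset.pair_comm _ _
  · intro i j
    exact hπ _ _ ((hf' i).2.trans (hf' j).2.symm)
end Frame

section Coord
variable {Λ : Type*} [AddCommGroup Λ] {B : Λ →ₗ[ℤ] Λ →ₗ[ℤ] ℤ}

structure Coord (B : Λ →ₗ[ℤ] Λ →ₗ[ℤ] ℤ) (c : Λ →+ (Fin 24 → ℤ)) : Prop where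
  dot : ∀ x y, ∑ i, c x i * c y i = 8 * B x y
  par : ∀ x i j, (2:ℤ) ∣ c x i - c x j
  dual : ∀ w : Fin 24 → ℤ, (∀ x, (8:ℤ) ∣ ∑ i, w i * c x i) → ∃ x, c x = w

theorem indep_of_ortho {ι : Type*} [Fintype ι] (g : ι → Λ) (h0 : ∀ i, B (g i) (g i) ≠ 0)
    (h1 : ∀ i j, i ≠ j → B (g i) (g j) = 0) : LinearIndependent ℤ g := by
  rw [Fintype.linearIndependent_iff]
  intro a ha i
  have h := congrArg (fun v => B v (g i)) ha
  simp only [map_sum, map_smul, LinearMap.sum_apply, LinearMap.smul_apply, smul_eq_mul, map_zero, LinearMap.zero_apply] at h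
  rw [Finset.sum_eq_single i] at h
  · exact (mul_eq_zero.1 h).resolve_right (h0 i)
  · intro j _ hj; rw [h1 j i hj, mul_zero]
  · simp

theorem coord_exists [Module.Free ℤ Λ] [Module.Finite ℤ Λ] (hB : IsLeech B) (hrank : finrank ℤ Λ = 24) :
    ∃ c : Λ →+ (Fin 24 → ℤ), Coord B c := by
  obtain ⟨f, f8, f0, f2⟩ := frame hB hrank
  let c : Λ →+ (Fin 24 → ℤ) := AddMonoidHom.mk' (fun x i => B x (f i)) (fun x y => by ext i; simp)
  have hexp : ∀ x, (8:ℤ) • x = ∑ i, c x i • f i := by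
    intro x
    by_contra hne
    let w := (8:ℤ) • x - ∑ i, c x i • f i
    have hw : w ≠ 0 := sub_ne_zero.2 hne
    have hwf : ∀ j, B w (f j) = 0 := by
      intro j
      simp only [w, map_sub, map_sum, map_smul, LinearMap.sub_apply, LinearMap.sum_apply, LinearMap.smul_apply, smul_eq_mul]
      rw [Finset.sum_eq_single j]
      · rw [f8]; simp [c]; ring
      · intro i _ hi; rw [f0 i j hi, mul_zero]
      · simp
    let g : Option (Fin 24) → Λ := fun o => o.elim w f
    have hli : LinearIndependent ℤ g := by
      apply indep_of_ortho (B := B)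
      · rintro (_ | i)
        · exact (hB.pos w hw).ne'
        · simp [g, f8]
      · rintro (_ | i) (_ | j) hij
        · exact absurd rfl hij
        · exact hwf j
        · simp only [g, Option.elim]; rw [hB.symm]; exact hwf i
        · exact f0 i j (fun h => hij (by rw [h]))
    have := hli.fintype_card_le_finrank
    rw [hrank] at this
    simp at this
  have hdot : ∀ x y, ∑ i, c x i * c y i = 8 * B x y := by
    intro x y
    have h := congrArg (fun v => B v y) (hexp x)
    simp only [map_sum, map_smul, LinearMap.sum_apply, LinearMap.smul_apply, smul_eq_mul] at h
    rw [h]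
    refine Finset.sum_congr rfl fun i _ => ?_
    rw [hB.symm (f i) y]; rfl
  refine ⟨c, hdot, ?_, ?_⟩
  · intro x i j
    obtain ⟨y, hy⟩ := f2 i j
    refine ⟨B x y, ?_⟩
    change B x (f i) - B x (f j) = _
    rw [← map_sub, hy]; simp
  · intro w hw
    choose g hg using hw
    let ℓ : Λ →+ ℤ := AddMonoidHom.mk' g (fun x y => by
      have h1 := hg (x + y)
      simp only [map_add, Pi.add_apply, mul_add, Finset.sum_add_distrib] at h1
      rw [hg x, hg y] at h1
      linarith)
    obtain ⟨z, hz⟩ := hB.unimod.2 ℓ.toIntLinearMap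
    refine ⟨z, ?_⟩
    ext j
    change B z (f j) = w j
    rw [hz]
    change g (f j) = w j
    have h1 := hg (f j)
    rw [Finset.sum_eq_single j] at h1
    · change w j * B (f j) (f j) = _ at h1
      rw [f8] at h1; linarith
    · intro i _ hi; change w i * B (f j) (f i) = 0; rw [f0 j i hi.symm, mul_zero]
    · simp

/-- sign changes and permutations -/
theorem Coord.twist {c : Λ →+ (Fin 24 → ℤ)} (hc : Coord B c) (s : Fin 24 → ℤ) (hs : ∀ i, s i = 1 ∨ s i = -1)
    (σ : Equiv.Perm (Fin 24)) :
    Coord B (AddMonoidHom.mk' (fun x i => s i * c x (σ i)) (fun x y => by ext i; simp [mul_add])) := by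
  have hss : ∀ i, s i * s i = 1 := fun i => by rcases hs i with h | h <;> rw [h] <;> norm_num
  refine ⟨?_, ?_, ?_⟩
  · intro x y
    rw [← hc.dot x y, ← Equiv.sum_comp σ (fun i => c x i * c y i)]
    refine Finset.sum_congr rfl fun i _ => ?_
    simp only [AddMonoidHom.mk'_apply]
    linear_combination (c x (σ i) * c y (σ i)) * hss i
  · intro x i j
    have := hc.par x (σ i) (σ j)
    simp only [AddMonoidHom.mk'_apply]
    rcases hs i with h | h <;> rcases hs j with h' | h' <;> rw [h, h'] <;> omega
  · intro w hw
    obtain ⟨x, hx⟩ := hc.dual (fun i => s (σ.symm i) * w (σ.symm i)) (fun x => by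
      have := hw x
      rw [← Equiv.sum_comp σ]
      simp only [AddMonoidHom.mk'_apply, Equiv.symm_apply_apply] at this ⊢
      convert this using 2
      ring_nf)
    refine ⟨x, ?_⟩
    ext i
    simp only [AddMonoidHom.mk'_apply, hx, Equiv.symm_apply_apply]
    rw [← mul_assoc, hss, one_mul]

theorem Coord.four {c : Λ →+ (Fin 24 → ℤ)} (hc : Coord B c) (w : Fin 24 → ℤ) (hw : ∀ i, 4 ∣ w i) (hs : 8 ∣ ∑ i, w i) :
    ∃ x, c x = w := by
  apply hc.dual
  intro x
  have h : ∑ i, w i * c x i = ∑ i, w i * (c x i - c x 0) + c x 0 * ∑ i, w i := by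
    rw [Finset.mul_sum, ← Finset.sum_add_distrib]
    refine Finset.sum_congr rfl fun i _ => ?_
    ring
  rw [h]
  refine dvd_add (Finset.dvd_sum fun i _ => ?_) (Dvd.dvd.mul_left hs _)
  exact (by norm_num : (8:ℤ) = 4 * 2) ▸ mul_dvd_mul (hw i) (hc.par x i 0)

theorem Coord.ne16 (hB : IsLeech B) {c : Λ →+ (Fin 24 → ℤ)} (hc : Coord B c) (x : Λ) : ∑ i, c x i * c x i ≠ 16 := by
  rw [hc.dot]
  have := hB.noroot x
  omega

theorem Coord.exists_odd (hB : IsLeech B) {c : Λ →+ (Fin 24 → ℤ)} (hc : Coord B c) : ∃ x, ∀ i, ¬ (2:ℤ) ∣ c x i := by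
  by_contra hcon
  push Not at hcon
  have hev : ∀ x i, (2:ℤ) ∣ c x i := fun x i => by
    obtain ⟨j, hj⟩ := hcon x
    have := hc.par x i j
    omega
  obtain ⟨x, hx⟩ := hc.dual (Pi.single 0 4) (fun x => by
    rw [Finset.sum_eq_single 0]
    · simp only [Pi.single_eq_same]
      have := hev x 0
      omega
    · intro i _ hi; simp [Pi.single_eq_of_ne hi]
    · simp)
  apply hc.ne16 hB x
  rw [hx, Finset.sum_eq_single 0]
  · simp
  · intro i _ hi; simp [Pi.single_eq_of_ne hi]
  · simp

theorem coord_norm [Module.Free ℤ Λ] [Module.Finite ℤ Λ] (hB : IsLeech B) (hrank : finrank ℤ Λ = 24) :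
    ∃ c : Λ →+ (Fin 24 → ℤ), Coord B c ∧ ∃ x, ∀ i, (4:ℤ) ∣ c x i - 1 := by
  obtain ⟨c, hc⟩ := coord_exists hB hrank
  obtain ⟨x, hx⟩ := hc.exists_odd hB
  refine ⟨_, hc.twist (fun i => if (4:ℤ) ∣ c x i - 1 then 1 else -1) (fun i => by split_ifs <;> simp) (Equiv.refl _), x, fun i => ?_⟩
  simp only [AddMonoidHom.mk'_apply, Equiv.refl_apply]
  have := hx i
  split_ifs with h <;> omega

/-- the code -/
def code (c : Λ →+ (Fin 24 → ℤ)) (s : Finset (Fin 24)) : Prop :=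
  ∃ x, ∃ y : Fin 24 → ℤ, (∀ i, c x i = 2 * y i) ∧ ∀ i, i ∈ s ↔ ¬ (2:ℤ) ∣ y i

structure IsGolay (C : Finset (Fin 24) → Prop) : Prop where
  add : ∀ s t, C s → C t → C (symmDiff s t)
  four : ∀ s, C s → 4 ∣ s.card
  univ : C Finset.univ
  ge : ∀ s, C s → s ≠ ∅ → 8 ≤ s.card
  dual : ∀ t, (∀ s, C s → Even (s ∩ t).card) → C t

theorem sum_ind (s : Finset (Fin 24)) (g : Fin 24 → ℤ) : ∑ i, (if i ∈ s then g i else 0) = ∑ i ∈ s, g i := by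
  simp

theorem code_golay (hB : IsLeech B) {c : Λ →+ (Fin 24 → ℤ)} (hc : Coord B c) {x0 : Λ} (hx0 : ∀ i, (4:ℤ) ∣ c x0 i - 1) :
    IsGolay (code c) := by
  have h4 : ∀ s, code c s → 4 ∣ s.card := by
    rintro s ⟨x, y, hy, hs⟩
    have h1 := hc.dot x x
    obtain ⟨k, hk⟩ := hB.even x
    have h2 : ∑ i, (y i * y i - if i ∈ s then 1 else 0) + (s.card : ℤ) = 4 * k := by
      rw [Finset.sum_sub_distrib, sum_ind s (fun _ => 1)]
      simp only [hy] at h1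
      have : ∑ i, 2 * y i * (2 * y i) = 4 * ∑ i, y i * y i := by
        rw [Finset.mul_sum]; refine Finset.sum_congr rfl fun i _ => by ring
      rw [this] at h1
      simp
      linarith
    have h3 : (4:ℤ) ∣ ∑ i, (y i * y i - if i ∈ s then 1 else 0) := by
      refine Finset.dvd_sum fun i _ => ?_
      have := hs i
      by_cases hi : i ∈ s
      · rw [if_pos hi]
        obtain ⟨m, hm⟩ : ∃ m, y i = 2 * m + 1 := ⟨y i / 2, by have := this.1 hi; omega⟩
        exact ⟨m * m + m, by rw [hm]; ring⟩
      · rw [if_neg hi]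
        obtain ⟨m, hm⟩ : ∃ m, y i = 2 * m := ⟨y i / 2, by have := (not_congr this).1 hi; omega⟩
        exact ⟨m * m, by rw [hm]; ring⟩
    omega
  have hx2 : ∀ i, ¬ (2:ℤ) ∣ c x0 i := fun i => by have := hx0 i; omega
  refine ⟨?_, h4, ?_, ?_, ?_⟩
  · rintro s t ⟨x, y, hy, hs⟩ ⟨x', y', hy', hs'⟩
    refine ⟨x + x', y + y', fun i => ?_, fun i => ?_⟩
    · rw [map_add, Pi.add_apply, Pi.add_apply, hy, hy']; ring
    · rw [Finset.mem_symmDiff, hs, hs', Pi.add_apply]; omega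
  · refine ⟨x0 + x0, c x0, fun i => ?_, fun i => ?_⟩
    · rw [map_add, Pi.add_apply]; ring
    · simp [hx2]
  · intro s hs hne
    by_contra hlt
    have hd := h4 s hs
    have hpos := Finset.card_pos.2 (Finset.nonempty_iff_ne_empty.2 hne)
    have hcard : s.card = 4 := by omega
    obtain ⟨x, y, hy, hs⟩ := hs
    obtain ⟨k, hk⟩ := Finset.nonempty_iff_ne_empty.2 hne
    -- the vector of the required shape
    have main : ∀ v : Fin 24 → ℤ, (∀ i, v i * v i = if i ∈ s then 4 else 0) → (8:ℤ) ∣ ∑ i, (v i - c x i) → False := by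
      intro v hv h8
      obtain ⟨z, hz⟩ := hc.four (fun i => v i - c x i) (fun i => by
        have h1 := hs i
        have h2 := hv i
        rw [hy]
        by_cases hi : i ∈ s
        · rw [if_pos hi] at h2
          have h3 : v i = 2 ∨ v i = -2 := by
            have : (v i - 2) * (v i + 2) = 0 := by linarith
            rcases mul_eq_zero.1 this with h | h <;> omega
          have := h1.1 hi
          omega
        · rw [if_neg hi] at h2
          have h3 : v i = 0 := by simpa using h2
          have := (not_congr h1).1 hi
          omega) h8
      apply hc.ne16 hB (z + x)
      have : c (z + x) = v := by rw [map_add, hz]; ext i; simp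
      rw [this, Finset.sum_congr rfl (fun i _ => hv i), sum_ind s (fun _ => 4)]
      simp [hcard]
    have hsq : ∀ i, (if i ∈ s then (2:ℤ) else 0) * (if i ∈ s then (2:ℤ) else 0) = if i ∈ s then 4 else 0 := fun i => by
      split_ifs <;> norm_num
    have h4' : (4:ℤ) ∣ ∑ i, ((if i ∈ s then (2:ℤ) else 0) - c x i) := by
      refine Finset.dvd_sum fun i _ => ?_
      have h1 := hs i
      rw [hy]
      by_cases hi : i ∈ s
      · rw [if_pos hi]; have := h1.1 hi; omega
      · rw [if_neg hi]; have := (not_congr h1).1 hi; omega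
    by_cases h8 : (8:ℤ) ∣ ∑ i, ((if i ∈ s then (2:ℤ) else 0) - c x i)
    · exact main _ hsq h8
    · refine main (fun i => if i ∈ s then (if i = k then -2 else 2) else 0) (fun i => by split_ifs <;> norm_num) ?_
      have : ∑ i, ((if i ∈ s then (if i = k then (-2:ℤ) else 2) else 0) - c x i) = ∑ i, ((if i ∈ s then (2:ℤ) else 0) - c x i) - 4 := by
        have h5 : ∑ i, (if i = k then (4:ℤ) else 0) = 4 := by simp
        rw [← h5, ← Finset.sum_sub_distrib]
        refine Finset.sum_congr rfl fun i _ => ?_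
        by_cases hik : i = k
        · subst hik; simp [hk]; ring
        · simp [hik]
      rw [this]; omega
  · intro t ht
    have hu : code c Finset.univ := ⟨x0 + x0, c x0, fun i => by rw [map_add, Pi.add_apply]; ring, fun i => by simp [hx2]⟩
    have htu := ht _ hu
    rw [Finset.univ_inter] at htu
    have hindic : ∀ (v : Fin 24 → ℤ), ∑ i, (if i ∈ t then (2:ℤ) else 0) * v i = 2 * ∑ i ∈ t, v i := fun v => by
      rw [Finset.mul_sum, ← sum_ind t (fun i => 2 * v i)]
      refine Finset.sum_congr rfl fun i _ => ?_
      split_ifs <;> simp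
    -- even vectors
    have hev : ∀ x, (∀ i, (2:ℤ) ∣ c x i) → (8:ℤ) ∣ ∑ i, (if i ∈ t then (2:ℤ) else 0) * c x i := by
      intro x hx
      choose y hy using hx
      have hC : code c (Finset.univ.filter fun i => ¬ (2:ℤ) ∣ y i) := ⟨x, y, hy, fun i => by simp⟩
      have h1 := ht _ hC
      have h2 : (2:ℤ) ∣ ∑ i ∈ t, (y i - if ¬ (2:ℤ) ∣ y i then 1 else 0) := by
        refine Finset.dvd_sum fun i _ => ?_
        split_ifs <;> omega
      rw [Finset.sum_sub_distrib] at h2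
      have h3 : ∑ i ∈ t, (if ¬ (2:ℤ) ∣ y i then (1:ℤ) else 0) = (((Finset.univ.filter fun i => ¬ (2:ℤ) ∣ y i) ∩ t).card : ℤ) := by
        rw [Finset.sum_ite, Finset.sum_const_zero, add_zero, Finset.sum_const, nsmul_eq_mul, mul_one]
        congr 2
        ext i; simp [and_comm]
      rw [h3] at h2
      rw [hindic]
      have h4 : ∑ i ∈ t, c x i = 2 * ∑ i ∈ t, y i := by
        rw [Finset.mul_sum]; exact Finset.sum_congr rfl fun i _ => hy i
      rw [h4]
      obtain ⟨m, hm⟩ := h1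
      omega
    have hx0t : (4:ℤ) ∣ ∑ i, (if i ∈ t then (2:ℤ) else 0) * c x0 i := by
      rw [hindic]
      have h2 : (2:ℤ) ∣ ∑ i ∈ t, (c x0 i - 1) := Finset.dvd_sum fun i _ => by have := hx0 i; omega
      rw [Finset.sum_sub_distrib] at h2
      simp only [Finset.sum_const, nsmul_eq_mul, mul_one] at h2
      obtain ⟨m, hm⟩ := htu
      omega
    -- general finishing step
    have fin : ∀ a : ℤ, a = 0 ∨ a = 4 → (8:ℤ) ∣ ∑ i, (if i ∈ t then (2:ℤ) else 0) * c x0 i + a * c x0 0 → code c t := by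
      intro a ha h8
      have hsplit : ∀ x, ∑ i, ((if i ∈ t then (2:ℤ) else 0) + if i = 0 then a else 0) * c x i = ∑ i, (if i ∈ t then (2:ℤ) else 0) * c x i + a * c x 0 := by
        intro x
        simp only [add_mul, Finset.sum_add_distrib]
        congr 1
        simp
      have hevx : ∀ x, (∀ i, (2:ℤ) ∣ c x i) → (8:ℤ) ∣ ∑ i, (if i ∈ t then (2:ℤ) else 0) * c x i + a * c x 0 := by
        intro x hx
        have h1 := hev x hx
        obtain ⟨m, hm⟩ := hx 0
        rw [hm]
        rcases ha with rfl | rfl <;> omega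
      obtain ⟨z, hz⟩ := hc.dual (fun i => (if i ∈ t then (2:ℤ) else 0) + if i = 0 then a else 0) (fun x => by
        rw [hsplit]
        by_cases hx : (2:ℤ) ∣ c x 0
        · exact hevx x (fun i => by have := hc.par x i 0; omega)
        · have h1 := hevx (x - x0) (fun i => by
            rw [map_sub, Pi.sub_apply]
            have := hc.par x i 0
            have := hx2 i
            omega)
          rw [map_sub] at h1
          simp only [Pi.sub_apply, mul_sub, Finset.sum_sub_distrib] at h1
          omega)
      refine ⟨z, fun i => (if i ∈ t then 1 else 0) + if i = 0 then a / 2 else 0, fun i => ?_, fun i => ?_⟩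
      · rw [hz]
        rcases ha with rfl | rfl <;> dsimp only <;> split_ifs <;> norm_num
      · rcases ha with rfl | rfl <;> by_cases h : i ∈ t <;> simp only [h, if_true, if_false] <;> split_ifs <;> norm_num
    by_cases h8 : (8:ℤ) ∣ ∑ i, (if i ∈ t then (2:ℤ) else 0) * c x0 i
    · exact fin 0 (Or.inl rfl) (by simpa using h8)
    · refine fin 4 (Or.inr rfl) ?_
      have := hx2 0
      omega

/-- indicator vectors -/
theorem Coord.ind {c : Λ →+ (Fin 24 → ℤ)} (hc : Coord B c) {x0 : Λ} (hx0 : ∀ i, (4:ℤ) ∣ c x0 i - 1)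
    {s : Finset (Fin 24)} (hs : code c s) (h4 : 4 ∣ s.card) : ∃ x, c x = fun i => if i ∈ s then 2 else 0 := by
  obtain ⟨x, y, hy, hs⟩ := hs
  have hd : ∀ i, (4:ℤ) ∣ (if i ∈ s then 2 else 0) - c x i := fun i => by
    have h1 := hs i
    rw [hy]
    by_cases hi : i ∈ s
    · rw [if_pos hi]; have := h1.1 hi; omega
    · rw [if_neg hi]; have := (not_congr h1).1 hi; omega
  have h8 : (8:ℤ) ∣ ∑ i, ((if i ∈ s then 2 else 0) - c x i) := by
    have h1 := hc.dot x x0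
    have h2 : (8:ℤ) ∣ ∑ i, c x i * (c x0 i - 1) := by
      refine Finset.dvd_sum fun i _ => ?_
      obtain ⟨m, hm⟩ := hx0 i
      rw [hm, hy]
      exact ⟨y i * m, by ring⟩
    simp only [mul_sub, Finset.sum_sub_distrib, mul_one] at h2
    rw [Finset.sum_sub_distrib, sum_ind s (fun _ => 2)]
    simp only [Finset.sum_const, nsmul_eq_mul]
    obtain ⟨m, hm⟩ := h4
    rw [hm]
    push_cast
    omega
  obtain ⟨z, hz⟩ := hc.four _ hd h8
  exact ⟨z + x, by rw [map_add, hz]; ext i; simp⟩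

theorem Coord.u0 (hB : IsLeech B) {c : Λ →+ (Fin 24 → ℤ)} (hc : Coord B c) {x0 : Λ} (hx0 : ∀ i, (4:ℤ) ∣ c x0 i - 1) :
    ∃ x, c x = fun i => if i = 0 then -3 else 1 := by
  choose k hk using hx0
  have hk' : ∀ i, c x0 i = 1 + 4 * k i := fun i => by have := hk i; omega
  obtain ⟨m, hm⟩ := hB.even x0
  have h1 := hc.dot x0 x0
  have h2 : ∑ i, c x0 i * c x0 i = 24 + 8 * ∑ i, k i + 16 * ∑ i, k i * k i := by
    rw [Finset.mul_sum, Finset.mul_sum]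
    have : (24:ℤ) = ∑ i : Fin 24, 1 := by simp
    rw [this, ← Finset.sum_add_distrib, ← Finset.sum_add_distrib]
    refine Finset.sum_congr rfl fun i _ => ?_
    rw [hk']; ring
  obtain ⟨z, hz⟩ := hc.four (fun i => (if i = 0 then -3 else 1) - c x0 i) (fun i => by
    rw [hk']; split_ifs <;> omega) (by
    have : ∑ i : Fin 24, ((if i = 0 then -3 else 1) - c x0 i) = -4 - 4 * ∑ i, k i := by
      rw [Finset.sum_sub_distrib, Finset.sum_congr rfl (fun i _ => hk' i), Finset.sum_add_distrib, ← Finset.mul_sum]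
      have h5 : ∑ i : Fin 24, (if i = 0 then (-3:ℤ) else 1) = 20 := by decide
      rw [h5]; simp; ring
    rw [this]
    omega)
  exact ⟨z + x0, by rw [map_add, hz]; ext i; simp⟩
end Coord

section Golay
variable {C : Finset (Fin 24) → Prop}

theorem card_sd {α : Type*} [DecidableEq α] (s t : Finset α) : (symmDiff s t).card + 2 * (s ∩ t).card = s.card + t.card := by
  have h1 : (symmDiff s t).card = (s \ t).card + (t \ s).card := by
    rw [symmDiff_def, Finset.sup_eq_union, Finset.card_union_of_disjoint disjoint_sdiff_sdiff]
  have h2 := Finset.card_sdiff_add_card_inter s t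
  have h3 := Finset.card_sdiff_add_card_inter t s
  rw [Finset.inter_comm t s] at h3
  omega

theorem card_sd_inter {α : Type*} [DecidableEq α] (s t u : Finset α) :
    (symmDiff s t ∩ u).card + 2 * (s ∩ t ∩ u).card = (s ∩ u).card + (t ∩ u).card := by
  have h := card_sd (s ∩ u) (t ∩ u)
  have e1 : symmDiff (s ∩ u) (t ∩ u) = symmDiff s t ∩ u := by
    ext x; simp only [Finset.mem_symmDiff, Finset.mem_inter]; tauto
  have e2 : (s ∩ u) ∩ (t ∩ u) = s ∩ t ∩ u := by
    ext x; simp only [Finset.mem_inter]; tauto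
  rw [e1, e2] at h
  exact h

theorem IsGolay.even (hC : IsGolay C) {s t : Finset (Fin 24)} (hs : C s) (ht : C t) : Even (s ∩ t).card := by
  have h := card_sd s t
  obtain ⟨a, ha⟩ := hC.four _ hs
  obtain ⟨b, hb⟩ := hC.four _ ht
  obtain ⟨d, hd⟩ := hC.four _ (hC.add _ _ hs ht)
  rw [Nat.even_iff]; omega

theorem IsGolay.compl (hC : IsGolay C) {s : Finset (Fin 24)} (hs : C s) : C sᶜ := by
  have := hC.add _ _ hC.univ hs
  have e : symmDiff Finset.univ s = sᶜ := by ext x; simp [Finset.mem_symmDiff]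
  rwa [e] at this

theorem IsGolay.empty (hC : IsGolay C) : C ∅ := by
  have := hC.add _ _ hC.univ hC.univ
  rwa [symmDiff_self] at this

/-- restrictions of the code -/
theorem IsGolay.restrict (hC : IsGolay C) (S T : Finset (Fin 24)) (hTS : T ⊆ S)
    (h : ∀ s, C s → s ⊆ S → Even (s ∩ T).card) : ∃ s, C s ∧ s ∩ S = T := by
  classical
  by_contra hcon
  push Not at hcon
  let ind : Finset (Fin 24) → (Fin 24 → ZMod 2) := fun s i => if i ∈ s then 1 else 0
  have hind : ∀ s t i, ind (symmDiff s t) i = ind s i + ind t i := by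
    intro s t i
    simp only [ind, Finset.mem_symmDiff]
    have : (1:ZMod 2) + 1 = 0 := by decide
    by_cases h1 : i ∈ s <;> by_cases h2 : i ∈ t <;> simp [h1, h2, this]
  let W : Submodule (ZMod 2) (Fin 24 → ZMod 2) :=
    { carrier := {v | ∃ s, C s ∧ ∀ i ∈ S, v i = ind s i}
      zero_mem' := ⟨∅, hC.empty, fun i _ => by simp [ind]⟩
      add_mem' := by
        rintro v v' ⟨s, hs, h1⟩ ⟨s', hs', h2⟩
        exact ⟨_, hC.add _ _ hs hs', fun i hi => by rw [Pi.add_apply, h1 i hi, h2 i hi, hind]⟩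
      smul_mem' := by
        rintro a v ⟨s, hs, h1⟩
        have ha : a = 0 ∨ a = 1 := by revert a; decide
        rcases ha with rfl | rfl
        · exact ⟨∅, hC.empty, fun i _ => by simp [ind]⟩
        · exact ⟨s, hs, fun i hi => by simp [h1 i hi]⟩ }
  have hW : ∀ v, v ∈ W ↔ ∃ s, C s ∧ ∀ i ∈ S, v i = ind s i := fun v => Iff.rfl
  have hT : ind T ∉ W := by
    rw [hW]
    rintro ⟨s, hs, h1⟩
    apply hcon s hs
    ext i
    rw [Finset.mem_inter]
    constructor
    · rintro ⟨hi, hiS⟩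
      have := h1 i hiS
      by_contra hiT
      simp [ind, hi, hiT] at this
    · intro hiT
      have := h1 i (hTS hiT)
      refine ⟨?_, hTS hiT⟩
      by_contra his
      simp [ind, his, hiT] at this
  obtain ⟨ℓ, hℓ, hle⟩ := Submodule.exists_le_ker_of_notMem hT
  let w : Finset (Fin 24) := Finset.univ.filter fun i => ℓ (Pi.single i 1) ≠ 0
  have hval : ∀ s, ℓ (ind s) = ((s ∩ w).card : ZMod 2) := by
    intro s
    have h1 : ind s = ∑ i ∈ s, Pi.single i (1 : ZMod 2) := by
      ext j
      simp [ind, Finset.sum_apply, Pi.single_apply]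
    rw [h1, map_sum, Finset.card_eq_sum_ones, Nat.cast_sum, Finset.sum_congr (show s ∩ w = s.filter (fun i => ℓ (Pi.single i 1) ≠ 0) by ext; simp [w]) (fun _ _ => rfl), Finset.sum_filter]
    refine Finset.sum_congr rfl fun i _ => ?_
    have : ∀ a : ZMod 2, a = if a ≠ 0 then ((1:ℕ) : ZMod 2) else 0 := by decide
    exact this _
  have hwS : w ⊆ S := by
    intro i hi
    by_contra hiS
    have : Pi.single i (1 : ZMod 2) ∈ W := by
      rw [hW]
      refine ⟨∅, hC.empty, fun j hj => ?_⟩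
      have : j ≠ i := fun h => hiS (h ▸ hj)
      simp [ind, Pi.single_apply, this]
    have := hle this
    rw [LinearMap.mem_ker] at this
    simp [w] at hi
    exact hi this
  have hwC : C w := by
    apply hC.dual
    intro s hs
    have : ind s ∈ W := (hW _).2 ⟨s, hs, fun _ _ => rfl⟩
    have := hle this
    rw [LinearMap.mem_ker, hval] at this
    exact (ZMod.natCast_eq_zero_iff_even).1 this
  have hev := h w hwC hwS
  apply hℓ
  rw [hval, Finset.inter_comm]
  exact (ZMod.natCast_eq_zero_iff_even).2 hev

theorem IsGolay.card_cases (hC : IsGolay C) {s : Finset (Fin 24)} (hs : C s) :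
    s.card = 0 ∨ s.card = 8 ∨ s.card = 12 ∨ s.card = 16 ∨ s.card = 24 := by
  have h4 := hC.four s hs
  have h1 := hC.ge s hs
  have h2 := hC.ge _ (hC.compl hs)
  have h3 : s.card + sᶜ.card = 24 := by simpa using Finset.card_add_card_compl s
  by_cases e1 : s = ∅
  · left; simp [e1]
  by_cases e2 : sᶜ = ∅
  · rw [e2] at h3; simp at h3; omega
  have := h1 e1
  have := h2 e2
  omega

theorem IsGolay.dodecad (hC : IsGolay C) : ∃ D, C D ∧ D.card = 12 := by
  have h01 : ¬ C {0, 1} := fun h => by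
    have := hC.four _ h
    simp at this
  have : ∃ s, C s ∧ ¬ Even (s ∩ {0, 1}).card := by
    by_contra hcon
    push Not at hcon
    exact h01 (hC.dual _ fun s hs => by simpa using hcon s hs)
  obtain ⟨s, hs, hodd⟩ := this
  have hoct : (∃ D, C D ∧ D.card = 12) ∨ ∃ O, C O ∧ O.card = 8 := by
    rcases hC.card_cases hs with h | h | h | h | h
    · rw [Finset.card_eq_zero] at h; simp [h] at hodd
    · exact Or.inr ⟨s, hs, h⟩
    · exact Or.inl ⟨s, hs, h⟩
    · refine Or.inr ⟨sᶜ, hC.compl hs, ?_⟩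
      have h3 : s.card + sᶜ.card = 24 := by simpa using Finset.card_add_card_compl s
      omega
    · have : s = Finset.univ := (Finset.card_eq_iff_eq_univ s).1 (by simpa using h)
      rw [this] at hodd; simp at hodd
  rcases hoct with h | ⟨O, hO, hO8⟩
  · exact h
  obtain ⟨T, hTO, hT2⟩ := Finset.exists_subset_card_eq (show 2 ≤ O.card by omega)
  obtain ⟨c, hc, hcO⟩ := hC.restrict O T hTO (by
    intro s hs hsO
    by_cases e : s = ∅
    · simp [e]
    · have := hC.ge s hs e
      have : s = O := Finset.eq_of_subset_of_card_le hsO (by omega)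
      rw [this, Finset.inter_eq_right.2 hTO, hT2]; decide)
  have h1 := card_sd c O
  rw [hcO, hT2, hO8] at h1
  have h2 := hC.add _ _ hc hO
  have h3 : 2 ≤ c.card := by rw [← hT2, ← hcO]; exact Finset.card_le_card Finset.inter_subset_left
  rcases hC.card_cases hc with h | h | h | h | h
  · omega
  · exact ⟨_, h2, by omega⟩
  · exact ⟨c, hc, h⟩
  · rcases hC.card_cases h2 with h' | h' | h' | h' | h' <;> omega
  · rcases hC.card_cases h2 with h' | h' | h' | h' | h' <;> omega

/-- a codeword meeting a dodecad in 2 points has 6 points outside -/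
theorem IsGolay.two_six (hC : IsGolay C) {D s : Finset (Fin 24)} (hD : C D) (hD12 : D.card = 12) (hs : C s)
    (h2 : (s ∩ D).card = 2) : s.card = 8 := by
  have h1 := card_sd s D
  have h3 := card_sd s Dᶜ
  have hc : D.card + Dᶜ.card = 24 := by simpa using Finset.card_add_card_compl D
  have h4 : (s ∩ Dᶜ).card + (s ∩ D).card = s.card := by
    have := Finset.card_sdiff_add_card_inter s D
    rwa [Finset.sdiff_eq_inter_compl] at this
  have h5 : (s ∩ Dᶜ).card ≤ Dᶜ.card := Finset.card_le_card Finset.inter_subset_right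
  rcases hC.card_cases hs with h | h | h | h | h <;>
  rcases hC.card_cases (hC.add _ _ hs hD) with h' | h' | h' | h' | h' <;>
  rcases hC.card_cases (hC.add _ _ hs (hC.compl hD)) with h'' | h'' | h'' | h'' | h'' <;> omega

theorem IsGolay.octads (hC : IsGolay C) {D : Finset (Fin 24)} (hD : C D) (hD12 : D.card = 12) {a p : Fin 24} (ha : a ∈ D)
    (hp : p ∉ D) {d : Fin 24} (hd : d ∈ D) (hda : d ≠ a) : ∃ c, C c ∧ c.card = 8 ∧ c ∩ D = {a, d} ∧ p ∈ c := by
  have h2 : ({a, d} : Finset (Fin 24)).card = 2 := Finset.card_pair hda.symm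
  have hsub : ({a, d} : Finset (Fin 24)) ⊆ D := by
    intro x hx; simp only [Finset.mem_insert, Finset.mem_singleton] at hx; rcases hx with rfl | rfl <;> assumption
  obtain ⟨c, hc, hcD⟩ := hC.restrict D {a, d} hsub (by
    intro s hs hsD
    by_cases e : s = ∅
    · simp [e]
    · have h1 := hC.ge s hs e
      have h3 := card_sd s D
      rw [Finset.inter_eq_left.2 hsD] at h3
      have h4 := Finset.card_le_card hsD
      have : s = D := Finset.eq_of_subset_of_card_le hsD (by
        rcases hC.card_cases (hC.add _ _ hs hD) with h' | h' | h' | h' | h' <;> omega)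
      rw [this, Finset.inter_eq_right.2 hsub, h2]; decide)
  by_cases hpc : p ∈ c
  · exact ⟨c, hc, hC.two_six hD hD12 hc (by rw [hcD, h2]), hcD, hpc⟩
  · have h1 := hC.add _ _ hc (hC.compl hD)
    have h3 : symmDiff c Dᶜ ∩ D = {a, d} := by
      rw [← hcD]; ext x; simp only [Finset.mem_inter, Finset.mem_symmDiff, Finset.mem_compl]; tauto
    refine ⟨_, h1, hC.two_six hD hD12 h1 (by rw [h3, h2]), h3, ?_⟩
    simp [Finset.mem_symmDiff, hpc, hp]

theorem IsGolay.octads_meet (hC : IsGolay C) {D : Finset (Fin 24)} (hD : C D) (hD12 : D.card = 12) {a d d' : Fin 24}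
    (hda : d ≠ a) (hda' : d' ≠ a) (hdd : d ≠ d') {c c' : Finset (Fin 24)} (hc : C c) (hc' : C c') (h8 : c.card = 8) (h8' : c'.card = 8)
    (h : c ∩ D = {a, d}) (h' : c' ∩ D = {a, d'}) : (c ∩ c').card = 4 := by
  have h1 := card_sd c c'
  have h2 : symmDiff c c' ∩ D = {d, d'} := by
    have : symmDiff c c' ∩ D = symmDiff (c ∩ D) (c' ∩ D) := by
      ext x; simp only [Finset.mem_inter, Finset.mem_symmDiff]; tauto
    rw [this, h, h']
    ext x; simp only [Finset.mem_symmDiff, Finset.mem_insert, Finset.mem_singleton]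
    constructor
    · tauto
    · rintro (rfl | rfl)
      · left; tauto
      · right; exact ⟨Or.inr rfl, by rintro (h | h); exacts [hda' h, hdd h.symm]⟩
  have := hC.two_six hD hD12 (hC.add _ _ hc hc') (by rw [h2]; exact Finset.card_pair hdd)
  omega
end Golay

section Label

def triples : List (Finset (Fin 6)) :=
  [{0,1,2},{0,1,3},{0,1,4},{0,1,5},{0,2,3},{0,2,4},{0,2,5},{0,3,4},{0,3,5},{0,4,5},
   {1,2,3},{1,2,4},{1,2,5},{1,3,4},{1,3,5},{1,4,5},{2,3,4},{2,3,5},{2,4,5},{3,4,5}]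

theorem mem_triples : ∀ t : Finset (Fin 6), t.card = 3 → t ∈ triples := by decide +kernel

theorem label1 : ∀ A ∈ triples, ∀ B ∈ triples, (A ∩ B).card = 2 → ∀ C ∈ triples, (A ∩ C).card = 2 → (B ∩ C).card = 1 →
    ∃ w1 ∈ A ∩ B, w1 ∈ C ∧ ∃ w0 ∈ A, w0 ∈ C \ B ∧ ∃ w2 ∈ A, w2 ∈ B \ C ∧ ∃ w3 ∈ B, w3 ∉ A ∧ ∃ w4 ∈ C, w4 ∉ A ∧
    ∃ w5, w5 ∉ A ∪ (B ∪ C) ∧ [w0, w1, w2, w3, w4, w5].Nodup ∧ A = {w0, w1, w2} ∧ B = {w1, w2, w3} ∧ C = {w0, w1, w4} := by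
  decide +kernel

set_option synthInstance.maxSize 2000 in
set_option synthInstance.maxHeartbeats 400000 in
set_option maxRecDepth 10000 in
theorem label2 : 
    ∀ t34 ∈ triples, (t34 ∩ {0,1,2}).card = 2 → (t34 ∩ {1,2,3}).card = 1 → (t34 ∩ {0,1,4}).card = 1 →
    ∀ t02 ∈ triples, (t02 ∩ {0,1,2}).card = 1 → (t02 ∩ {1,2,3}).card = 1 → (t02 ∩ {0,1,4}).card = 1 → (t02 ∩ t34).card = 2 →
    ∀ t03 ∈ triples, (t03 ∩ {0,1,2}).card = 1 → (t03 ∩ {1,2,3}).card = 1 → (t03 ∩ {0,1,4}).card = 2 → (t03 ∩ t34).card = 1 → (t03 ∩ t02).card = 1 →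
    ∀ t04 ∈ triples, (t04 ∩ {0,1,2}).card = 1 → (t04 ∩ {1,2,3}).card = 2 → (t04 ∩ {0,1,4}).card = 1 → (t04 ∩ t34).card = 1 → (t04 ∩ t02).card = 1 → (t04 ∩ t03).card = 1 →
    ∀ t12 ∈ triples, (t12 ∩ {0,1,2}).card = 1 → (t12 ∩ {1,2,3}).card = 1 → (t12 ∩ {0,1,4}).card = 1 → (t12 ∩ t34).card = 2 → (t12 ∩ t02).card = 1 → (t12 ∩ t03).card = 2 → (t12 ∩ t04).card = 2 →
    ∀ t13 ∈ triples, (t13 ∩ {0,1,2}).card = 1 → (t13 ∩ {1,2,3}).card = 1 → (t13 ∩ {0,1,4}).card = 2 → (t13 ∩ t34).card = 1 → (t13 ∩ t02).card = 2 → (t13 ∩ t03).card = 1 → (t13 ∩ t04).card = 2 → (t13 ∩ t12).card = 1 →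
    ∀ t14 ∈ triples, (t14 ∩ {0,1,2}).card = 1 → (t14 ∩ {1,2,3}).card = 2 → (t14 ∩ {0,1,4}).card = 1 → (t14 ∩ t34).card = 1 → (t14 ∩ t02).card = 2 → (t14 ∩ t03).card = 2 → (t14 ∩ t04).card = 1 → (t14 ∩ t12).card = 1 → (t14 ∩ t13).card = 1 →
    (t34 = {0,2,5} ∧ t02 = {0,3,5} ∧ t03 = {1,4,5} ∧ t04 = {2,3,4} ∧ t12 = {2,4,5} ∧ t13 = {0,3,4} ∧ t14 = {1,3,5}) ∨
    (t34 = {0,2,5} ∧ t12 = {0,3,5} ∧ t13 = {1,4,5} ∧ t14 = {2,3,4} ∧ t02 = {2,4,5} ∧ t03 = {0,3,4} ∧ t04 = {1,3,5}) := by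
  decide +kernel


def Tstd : Fin 5 → Fin 5 → Finset (Fin 6) := ![![∅, {0,1,2}, {0,3,5}, {1,4,5}, {2,3,4}], ![∅, ∅, {2,4,5}, {0,3,4}, {1,3,5}],
  ![∅, ∅, ∅, {1,2,3}, {0,1,4}], ![∅, ∅, ∅, ∅, {0,2,5}], ![∅, ∅, ∅, ∅, ∅]]

def pre (w : Fin 6 → Fin 24) (T : Finset (Fin 24)) : Finset (Fin 6) := Finset.univ.filter (fun i => w i ∈ T)

theorem pre_inter (w : Fin 6 → Fin 24) (T T' : Finset (Fin 24)) : pre w T ∩ pre w T' = pre w (T ∩ T') := by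
  ext i; simp [pre]

theorem image_pre {w : Fin 6 → Fin 24} {W T : Finset (Fin 24)} (hW : ∀ y ∈ W, ∃ i, w i = y) (hT : T ⊆ W) :
    (pre w T).image w = T := by
  ext y
  simp only [pre, Finset.mem_image, Finset.mem_filter, Finset.mem_univ, true_and]
  constructor
  · rintro ⟨i, hi, rfl⟩; exact hi
  · intro hy
    obtain ⟨i, rfl⟩ := hW y (hT hy)
    exact ⟨i, hy, rfl⟩

theorem card_pre {w : Fin 6 → Fin 24} (hw : Function.Injective w) {W T : Finset (Fin 24)} (hW : ∀ y ∈ W, ∃ i, w i = y) (hT : T ⊆ W) :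
    (pre w T).card = T.card := by
  conv_rhs => rw [← image_pre hW hT]
  rw [Finset.card_image_of_injective _ hw]

theorem label3 (W : Finset (Fin 24)) (hW : W.card = 6) (τ : Fin 5 → Fin 5 → Finset (Fin 24)) (hsym : ∀ i j, τ i j = τ j i)
    (hsub : ∀ i j, i ≠ j → τ i j ⊆ W) (h3 : ∀ i j, i ≠ j → (τ i j).card = 3)
    (h1 : ∀ i j k, i ≠ j → i ≠ k → j ≠ k → (τ i j ∩ τ i k).card = 1)
    (h2 : ∀ i j k l, i ≠ j → i ≠ k → i ≠ l → j ≠ k → j ≠ l → k ≠ l → (τ i j ∩ τ k l).card = 2) :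
    ∃ σ : Equiv.Perm (Fin 5), ∃ w : Fin 6 → Fin 24, (∀ y ∈ W, ∃ i, w i = y) ∧ 
      ∀ i j, i < j → τ (σ i) (σ j) = (Tstd i j).image w := by
  obtain ⟨w, hw, hwW⟩ : ∃ w : Fin 6 → Fin 24, Function.Injective w ∧ (∀ y ∈ W, ∃ i, w i = y) ∧
      pre w (τ 0 1) = {0,1,2} ∧ pre w (τ 2 3) = {1,2,3} ∧ pre w (τ 2 4) = {0,1,4} := by
    let v : Fin 6 → Fin 24 := fun i => W.orderEmbOfFin hW i
    have hv : Function.Injective v := (W.orderEmbOfFin hW).injective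
    have hvW : ∀ y ∈ W, ∃ i, v i = y := by
      intro y hy
      have := Finset.range_orderEmbOfFin W hW
      have hy' : y ∈ Set.range (W.orderEmbOfFin hW) := by rw [this]; exact hy
      exact hy'
    have c3 : ∀ i j, i ≠ j → pre v (τ i j) ∈ triples := fun i j h =>
      mem_triples _ ((card_pre hv hvW (hsub i j h)).trans (h3 i j h))
    have c2 : ∀ i j k l, i ≠ j → (pre v (τ i j) ∩ pre v (τ k l)).card = (τ i j ∩ τ k l).card := by
      intro i j k l h
      rw [pre_inter]
      exact card_pre hv hvW (Finset.inter_subset_left.trans (hsub i j h))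
    obtain ⟨w1, -, -, w0, -, -, w2, -, -, w3, -, -, w4, -, -, w5, -, hnd, e1, e2, e3⟩ := label1 (pre v (τ 0 1)) (c3 _ _ (by decide)) (pre v (τ 2 3)) (c3 _ _ (by decide))
      ((c2 _ _ _ _ (by decide)).trans (h2 _ _ _ _ (by decide) (by decide) (by decide) (by decide) (by decide) (by decide)))
      (pre v (τ 2 4)) (c3 _ _ (by decide))
      ((c2 _ _ _ _ (by decide)).trans (h2 _ _ _ _ (by decide) (by decide) (by decide) (by decide) (by decide) (by decide)))
      ((c2 _ _ _ _ (by decide)).trans (h1 _ _ _ (by decide) (by decide) (by decide)))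
    let u : Fin 6 → Fin 6 := ![w0, w1, w2, w3, w4, w5]
    have hu : Function.Injective u := by
      rw [← List.nodup_ofFn]
      simpa [u, List.ofFn_succ] using hnd
    have hus : Function.Surjective u := Finite.surjective_of_injective hu
    have key : ∀ T s, pre v T = Finset.image u s → pre (v ∘ u) T = s := by
      intro T s h
      ext i
      have : u i ∈ pre v T ↔ i ∈ s := by rw [h, hu.mem_finset_image]
      rw [← this]
      simp [pre]
    refine ⟨v ∘ u, hv.comp hu, ?_, ?_, ?_, ?_⟩
    · intro y hy
      obtain ⟨i, rfl⟩ := hvW y hy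
      obtain ⟨j, rfl⟩ := hus i
      exact ⟨j, rfl⟩
    · apply key; rw [e1]; simp [u]
    · apply key; rw [e2]; simp [u]
    · apply key; rw [e3]; simp [u]
  obtain ⟨hwW, e01, e23, e24⟩ := hwW
  have c3 : ∀ i j, i ≠ j → pre w (τ i j) ∈ triples := fun i j h =>
    mem_triples _ ((card_pre hw hwW (hsub i j h)).trans (h3 i j h))
  have c2 : ∀ i j k l, i ≠ j → (pre w (τ i j) ∩ pre w (τ k l)).card = (τ i j ∩ τ k l).card := by
    intro i j k l h
    rw [pre_inter]
    exact card_pre hw hwW (Finset.inter_subset_left.trans (hsub i j h))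
  have d1 : ∀ i j k l, i ≠ j → k ≠ l → ((i = k ∧ j ≠ l) ∨ (i = l ∧ j ≠ k) ∨ (j = k ∧ i ≠ l) ∨ (j = l ∧ i ≠ k)) → (pre w (τ i j) ∩ pre w (τ k l)).card = 1 := by
    intro i j k l hij hkl h
    rw [c2 _ _ _ _ hij]
    rcases h with ⟨rfl, h⟩ | ⟨rfl, h⟩ | ⟨rfl, h⟩ | ⟨rfl, h⟩
    · exact h1 _ _ _ hij hkl h
    · rw [hsym k i]; exact h1 _ _ _ hij hkl.symm h
    · rw [hsym i j]; exact h1 _ _ _ hij.symm hkl h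
    · rw [hsym i j, hsym k j]; exact h1 _ _ _ hij.symm hkl.symm h
  have d2 : ∀ i j k l, i ≠ j ∧ i ≠ k ∧ i ≠ l ∧ j ≠ k ∧ j ≠ l ∧ k ≠ l → (pre w (τ i j) ∩ pre w (τ k l)).card = 2 := by
    intro i j k l ⟨a, b, c, d, e, f⟩
    rw [c2 _ _ _ _ a]
    exact h2 _ _ _ _ a b c d e f
  have hfin : ∀ i j s, i ≠ j → pre w (τ i j) = s → τ i j = s.image w := by
    intro i j s hij h
    rw [← h, image_pre hwW (hsub i j hij)]
  have main := label2
  rw [← e01, ← e23, ← e24] at main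
  specialize main (pre w (τ 3 4)) (c3 _ _ (by decide)) (d2 _ _ _ _ (by decide)) (d1 _ _ _ _ (by decide) (by decide) (by decide)) (d1 _ _ _ _ (by decide) (by decide) (by decide))
    (pre w (τ 0 2)) (c3 _ _ (by decide)) (d1 _ _ _ _ (by decide) (by decide) (by decide)) (d1 _ _ _ _ (by decide) (by decide) (by decide)) (d1 _ _ _ _ (by decide) (by decide) (by decide)) (d2 _ _ _ _ (by decide))
    (pre w (τ 0 3)) (c3 _ _ (by decide)) (d1 _ _ _ _ (by decide) (by decide) (by decide)) (d1 _ _ _ _ (by decide) (by decide) (by decide)) (d2 _ _ _ _ (by decide)) (d1 _ _ _ _ (by decide) (by decide) (by decide)) (d1 _ _ _ _ (by decide) (by decide) (by decide))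
    (pre w (τ 0 4)) (c3 _ _ (by decide)) (d1 _ _ _ _ (by decide) (by decide) (by decide)) (d2 _ _ _ _ (by decide)) (d1 _ _ _ _ (by decide) (by decide) (by decide)) (d1 _ _ _ _ (by decide) (by decide) (by decide)) (d1 _ _ _ _ (by decide) (by decide) (by decide)) (d1 _ _ _ _ (by decide) (by decide) (by decide))
    (pre w (τ 1 2)) (c3 _ _ (by decide)) (d1 _ _ _ _ (by decide) (by decide) (by decide)) (d1 _ _ _ _ (by decide) (by decide) (by decide)) (d1 _ _ _ _ (by decide) (by decide) (by decide)) (d2 _ _ _ _ (by decide)) (d1 _ _ _ _ (by decide) (by decide) (by decide)) (d2 _ _ _ _ (by decide)) (d2 _ _ _ _ (by decide))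
    (pre w (τ 1 3)) (c3 _ _ (by decide)) (d1 _ _ _ _ (by decide) (by decide) (by decide)) (d1 _ _ _ _ (by decide) (by decide) (by decide)) (d2 _ _ _ _ (by decide)) (d1 _ _ _ _ (by decide) (by decide) (by decide)) (d2 _ _ _ _ (by decide)) (d1 _ _ _ _ (by decide) (by decide) (by decide)) (d2 _ _ _ _ (by decide)) (d1 _ _ _ _ (by decide) (by decide) (by decide))
    (pre w (τ 1 4)) (c3 _ _ (by decide)) (d1 _ _ _ _ (by decide) (by decide) (by decide)) (d2 _ _ _ _ (by decide)) (d1 _ _ _ _ (by decide) (by decide) (by decide)) (d1 _ _ _ _ (by decide) (by decide) (by decide)) (d2 _ _ _ _ (by decide)) (d2 _ _ _ _ (by decide)) (d1 _ _ _ _ (by decide) (by decide) (by decide)) (d1 _ _ _ _ (by decide) (by decide) (by decide)) (d1 _ _ _ _ (by decide) (by decide) (by decide))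
  have red : ∀ σ : Equiv.Perm (Fin 5), 
      τ (σ 0) (σ 1) = (Tstd 0 1).image w → τ (σ 0) (σ 2) = (Tstd 0 2).image w → τ (σ 0) (σ 3) = (Tstd 0 3).image w →
      τ (σ 0) (σ 4) = (Tstd 0 4).image w → τ (σ 1) (σ 2) = (Tstd 1 2).image w → τ (σ 1) (σ 3) = (Tstd 1 3).image w →
      τ (σ 1) (σ 4) = (Tstd 1 4).image w → τ (σ 2) (σ 3) = (Tstd 2 3).image w → τ (σ 2) (σ 4) = (Tstd 2 4).image w →
      τ (σ 3) (σ 4) = (Tstd 3 4).image w → ∀ i j, i < j → τ (σ i) (σ j) = (Tstd i j).image w := by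
    intro σ _ _ _ _ _ _ _ _ _ _ i j hij
    fin_cases i <;> fin_cases j <;> first | assumption | exact absurd hij (by decide)
  rcases main with ⟨e34, e02, e03, e04, e12, e13, e14⟩ | ⟨e34, e12, e13, e14, e02, e03, e04⟩
  · refine ⟨1, w, hwW, red 1 ?_ ?_ ?_ ?_ ?_ ?_ ?_ ?_ ?_ ?_⟩ <;> exact hfin _ _ _ (by decide) (by assumption)
  · refine ⟨Equiv.swap 0 1, w, hwW, red _ ?_ ?_ ?_ ?_ ?_ ?_ ?_ ?_ ?_ ?_⟩
    · exact (hsym 1 0).trans (hfin 0 1 _ (by decide) e01)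
    · exact hfin 1 2 _ (by decide) e12
    · exact hfin 1 3 _ (by decide) e13
    · exact hfin 1 4 _ (by decide) e14
    · exact hfin 0 2 _ (by decide) e02
    · exact hfin 0 3 _ (by decide) e03
    · exact hfin 0 4 _ (by decide) e04
    · exact hfin 2 3 _ (by decide) e23
    · exact hfin 2 4 _ (by decide) e24
    · exact hfin 3 4 _ (by decide) e34

end Label

section Golay2
variable {C : Finset (Fin 24) → Prop}

theorem card_split {D c : Finset (Fin 24)} {a d p : Fin 24} (hp : p ∉ D) (K : Finset (Fin 24)) (hKD : Disjoint K D) (hpK : p ∉ K)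
    (h : c ∩ D = {a, d}) (hpc : p ∈ c) (c' : Finset (Fin 24)) :
    (c ∩ c').card = ((({a, d} : Finset (Fin 24)) ∩ c').card + (if p ∈ c' then 1 else 0)) + ((c ∩ K ∩ c').card + (c ∩ (D ∪ {p} ∪ K)ᶜ ∩ c').card) := by
  have e : c ∩ c' = (({a, d} ∩ c') ∪ ({p} ∩ c')) ∪ ((c ∩ K ∩ c') ∪ (c ∩ (D ∪ {p} ∪ K)ᶜ ∩ c')) := by
    rw [← h]
    ext y
    simp only [Finset.mem_inter, Finset.mem_union, Finset.mem_compl, Finset.mem_singleton]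
    by_cases hy : y = p
    · subst hy; tauto
    · tauto
  have hd := Finset.disjoint_left.1 hKD
  have hh : ∀ y, y = a ∨ y = d → y ∈ D := by
    intro y hy
    have : y ∈ ({a, d} : Finset (Fin 24)) := by simpa using hy
    rw [← h] at this
    exact (Finset.mem_inter.1 this).2
  rw [e, Finset.card_union_of_disjoint, Finset.card_union_of_disjoint, Finset.card_union_of_disjoint]
  · congr 2
    split_ifs with hpc'
    · rw [Finset.inter_eq_left.2 (by simpa using hpc')]; simp
    · rw [Finset.card_eq_zero]; ext y; simp; rintro rfl; exact hpc'
  · rw [Finset.disjoint_left]; intro y; simp only [Finset.mem_inter, Finset.mem_union, Finset.mem_compl]; tauto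
  · rw [Finset.disjoint_left]; intro y; simp only [Finset.mem_inter, Finset.mem_singleton, Finset.mem_insert]
    rintro ⟨h1, -⟩ ⟨rfl, -⟩; exact hp (hh _ h1)
  · rw [Finset.disjoint_left]; intro y; simp only [Finset.mem_inter, Finset.mem_singleton, Finset.mem_insert, Finset.mem_union, Finset.mem_compl]
    rintro (⟨h1, -⟩ | ⟨rfl, -⟩) (h2 | h2)
    · exact hd h2.1.2 (hh _ h1)
    · exact h2.1.2 (Or.inl (Or.inl (hh _ h1)))
    · exact hpK h2.1.2
    · exact h2.1.2 (Or.inl (Or.inr rfl))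

theorem IsGolay.struct (hC : IsGolay C) : ∃ (D c0 K W : Finset (Fin 24)) (a d0 p : Fin 24) (dd : Finset (Fin 24) → Fin 24) (T : Finset (Fin 24) → Finset (Fin 24)),
    C Dᶜ ∧ C c0 ∧ D.card = 12 ∧ c0.card = 8 ∧ K.card = 5 ∧ W.card = 6 ∧ (∀ y, y ∉ D → y = p ∨ y ∈ K ∨ y ∈ W) ∧
    Dᶜ = insert p (K ∪ W) ∧ c0 = {a, d0, p} ∪ K ∧
    (∀ y ∈ D, y = a ∨ y = d0 ∨ ∃ Q, Q ⊆ K ∧ Q.card = 2 ∧ dd Q = y) ∧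
    (∀ Q, Q ⊆ K → Q.card = 2 → C ({a, dd Q, p} ∪ Q ∪ T Q) ∧ T Q ⊆ W ∧ (T Q).card = 3) ∧
    (∀ Q, Q ⊆ K → Q.card = 2 → ∀ Q', Q' ⊆ K → Q'.card = 2 → Q ≠ Q' → (T Q ∩ T Q').card + (Q ∩ Q').card = 2) := by
  classical
  obtain ⟨D, hD, hD12⟩ := hC.dodecad
  have hDc : Dᶜ.card = 12 := by
    have : D.card + Dᶜ.card = 24 := by simpa using Finset.card_add_card_compl D
    omega
  obtain ⟨a, ha, d0, hd0, had⟩ := Finset.one_lt_card.1 (show 1 < D.card by omega)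
  obtain ⟨p, hp⟩ := Finset.card_pos.1 (show 0 < Dᶜ.card by omega)
  rw [Finset.mem_compl] at hp
  have H : ∀ d, ∃ c, d ∈ D → d ≠ a → C c ∧ c.card = 8 ∧ c ∩ D = {a, d} ∧ p ∈ c := by
    intro d
    by_cases h : d ∈ D ∧ d ≠ a
    · obtain ⟨c, hc⟩ := hC.octads hD hD12 ha hp h.1 h.2
      exact ⟨c, fun _ _ => hc⟩
    · exact ⟨∅, fun h1 h2 => absurd ⟨h1, h2⟩ h⟩
  choose c hc using H
  obtain ⟨h0C, h08, h0D, h0p⟩ := hc d0 hd0 had.symm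
  obtain ⟨c0, hc0⟩ : ∃ c0, c0 = c d0 := ⟨_, rfl⟩
  rw [← hc0] at h0C h08 h0D h0p
  obtain ⟨K, hK⟩ : ∃ K, K = (c0 \ D).erase p := ⟨_, rfl⟩
  have hKD : Disjoint K D := by
    rw [Finset.disjoint_left]; intro y hy; simp [hK] at hy; exact hy.2.2
  have hpK : p ∉ K := by simp [hK]
  have c0eq : c0 = {a, d0, p} ∪ K := by
    have h1 : ∀ y, y ∈ c0 ∧ y ∈ D ↔ y = a ∨ y = d0 := by
      intro y; rw [← Finset.mem_inter, h0D]; simp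
    ext y
    simp only [hK, Finset.mem_union, Finset.mem_insert, Finset.mem_singleton, Finset.mem_erase, Finset.mem_sdiff]
    have := h1 y
    by_cases hy : y = p
    · subst hy; tauto
    · tauto
  have hKc : K ⊆ c0 := by rw [c0eq]; exact Finset.subset_union_right
  have hK5 : K.card = 5 := by
    rw [hK, Finset.card_erase_of_mem (by simp [h0p, hp])]
    have := Finset.card_sdiff_add_card_inter c0 D
    rw [h0D, Finset.card_pair had] at this
    omega
  obtain ⟨W, hW⟩ : ∃ W, W = (D ∪ {p} ∪ K)ᶜ := ⟨_, rfl⟩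
  have hW6 : W.card = 6 := by
    have h1 : (D ∪ {p} ∪ K).card = 18 := by
      rw [Finset.card_union_of_disjoint, Finset.card_union_of_disjoint, hD12, hK5]; simp
      · simpa using hp
      · rw [Finset.disjoint_union_left]; exact ⟨hKD.symm, by simpa using hpK⟩
    have : (D ∪ {p} ∪ K).card + W.card = 24 := by rw [hW, Finset.card_add_card_compl]; rfl
    omega
  -- intersection counts
  have hself : ∀ d ∈ D, d ≠ a → (c d ∩ K).card + (c d ∩ W).card = 5 := by
    intro d hd hda
    obtain ⟨g1, g2, g3, g4⟩ := hc d hd hda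
    have := card_split hp K hKD hpK g3 g4 Finset.univ
    rw [← hW] at this
    simp [g2, Finset.card_pair hda.symm] at this
    omega
  have hmeet : ∀ d ∈ D, d ≠ a → ∀ d' ∈ D, d' ≠ a → d ≠ d' → (c d ∩ K ∩ c d').card + (c d ∩ W ∩ c d').card = 2 := by
    intro d hd hda d' hd' hda' hdd
    obtain ⟨g1, g2, g3, g4⟩ := hc d hd hda
    obtain ⟨g1', g2', g3', g4'⟩ := hc d' hd' hda'
    have := card_split hp K hKD hpK g3 g4 (c d')
    rw [hC.octads_meet hD hD12 hda hda' hdd g1 g1' g2 g2' g3 g3', if_pos g4'] at this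
    have e : ({a, d} : Finset (Fin 24)) ∩ c d' = {a} := by
      ext y
      simp only [Finset.mem_inter, Finset.mem_insert, Finset.mem_singleton]
      constructor
      · rintro ⟨rfl | rfl, h⟩
        · rfl
        · have : y ∈ c d' ∩ D := Finset.mem_inter.2 ⟨h, hd⟩
          rw [g3'] at this
          simp at this
          rcases this with h | h
          · exact h
          · exact absurd h hdd
      · rintro rfl
        refine ⟨Or.inl rfl, ?_⟩
        have : y ∈ c d' ∩ D := by rw [g3']; simp
        exact (Finset.mem_inter.1 this).1
    rw [e, Finset.card_singleton, ← hW] at this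
    omega
  have hWc0 : W ∩ c0 = ∅ := by
    ext y; rw [Finset.mem_inter, c0eq]; simp only [hW, Finset.mem_compl, Finset.mem_union, Finset.mem_singleton, Finset.mem_insert, Finset.notMem_empty, iff_false]
    rintro ⟨h1, (rfl | rfl | rfl) | h⟩ <;> tauto
  have hK2 : ∀ d ∈ D, d ≠ a → d ≠ d0 → (c d ∩ K).card = 2 := by
    intro d hd hda hdd
    have := hmeet d hd hda d0 hd0 had.symm hdd
    rw [← hc0, Finset.inter_assoc, Finset.inter_assoc, hWc0, Finset.inter_empty, Finset.card_empty, Finset.inter_eq_left.2 hKc] at this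
    omega
  have hinj : ∀ d ∈ D, d ≠ a → d ≠ d0 → ∀ d' ∈ D, d' ≠ a → d' ≠ d0 → c d ∩ K = c d' ∩ K → d = d' := by
    intro d hd hda hdd d' hd' hda' hdd' he
    by_contra hne
    obtain ⟨g1, g2, g3, g4⟩ := hc d hd hda
    obtain ⟨g1', g2', g3', g4'⟩ := hc d' hd' hda'
    have m1 := hC.octads_meet hD hD12 had.symm hda hdd.symm h0C g1 h08 g2 h0D g3
    have m2 := hC.octads_meet hD hD12 had.symm hda' hdd'.symm h0C g1' h08 g2' h0D g3'
    have m3 := hC.octads_meet hD hD12 hda hda' hne g1 g1' g2 g2' g3 g3'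
    obtain ⟨s, hs⟩ : ∃ s, s = symmDiff (symmDiff c0 (c d)) (c d') := ⟨_, rfl⟩
    have hsC : C s := hs ▸ hC.add _ _ (hC.add _ _ h0C g1) g1'
    have i1 := card_sd c0 (c d)
    have i2 := card_sd (symmDiff c0 (c d)) (c d')
    rw [← hs] at i2
    have i3 := card_sd_inter c0 (c d) (c d')
    have trip : c0 ∩ c d ∩ c d' = c0 ∩ c d := by
      rw [Finset.inter_eq_left]
      intro y hy
      rw [Finset.mem_inter] at hy
      obtain ⟨y1, y2⟩ := hy
      rw [c0eq] at y1
      simp only [Finset.mem_union, Finset.mem_insert, Finset.mem_singleton] at y1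
      have hz : ∀ z ∈ ({a, d'} : Finset (Fin 24)), z ∈ c d' := by
        intro z hz; rw [← g3'] at hz; exact (Finset.mem_inter.1 hz).1
      rcases y1 with (rfl | rfl | rfl) | h
      · exact hz _ (by simp)
      · exfalso
        have : y ∈ c d ∩ D := Finset.mem_inter.2 ⟨y2, hd0⟩
        rw [g3] at this; simp at this
        rcases this with h | h
        · exact had h.symm
        · exact hdd h.symm
      · exact g4'
      · have : y ∈ c d ∩ K := Finset.mem_inter.2 ⟨y2, h⟩
        rw [he] at this; exact (Finset.mem_inter.1 this).1
    rw [trip] at i3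
    have s16 : s.card = 16 := by omega
    -- intersection with D
    have k1 := card_sd s D
    have k2 : (s ∩ D).card ≤ 4 := by
      have : s ∩ D ⊆ {a, d0, d, d'} := by
        intro y hy
        rw [Finset.mem_inter] at hy
        have a1 : y ∈ c0 ↔ y = a ∨ y = d0 := by
          have : y ∈ c0 ∩ D ↔ y ∈ ({a, d0} : Finset (Fin 24)) := by rw [h0D]
          simpa [hy.2] using this
        have a2 : y ∈ c d ↔ y = a ∨ y = d := by
          have : y ∈ c d ∩ D ↔ y ∈ ({a, d} : Finset (Fin 24)) := by rw [g3]
          simpa [hy.2] using this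
        have a3 : y ∈ c d' ↔ y = a ∨ y = d' := by
          have : y ∈ c d' ∩ D ↔ y ∈ ({a, d'} : Finset (Fin 24)) := by rw [g3']
          simpa [hy.2] using this
        have h1 := hy.1
        simp only [hs, Finset.mem_symmDiff] at h1
        simp only [Finset.mem_insert, Finset.mem_singleton]
        rcases h1 with ⟨h1 | h1, -⟩ | h1
        · rcases a1.1 h1.1 with h | h <;> simp [h]
        · rcases a2.1 h1.1 with h | h <;> simp [h]
        · rcases a3.1 h1.1 with h | h <;> simp [h]
      exact (Finset.card_le_card this).trans Finset.card_le_four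
    rcases hC.card_cases (hC.add _ _ hsC hD) with h | h | h | h | h <;> try omega
    -- remaining: symmDiff s D has card 24
    have := (Finset.card_le_univ (symmDiff s D))
    have hs' := card_sd s Dᶜ
    have hs4 := Finset.card_sdiff_add_card_inter s D
    rw [Finset.sdiff_eq_inter_compl] at hs4
    have hs5 : (s ∩ Dᶜ).card ≤ Dᶜ.card := Finset.card_le_card Finset.inter_subset_right
    rcases hC.card_cases (hC.add _ _ hsC (hC.compl hD)) with h | h | h | h | h <;> omega
  -- surjectivity onto pairs
  have hsurj : ∀ Q, ∃ d, Q ⊆ K → Q.card = 2 → (d ∈ D ∧ d ≠ a ∧ d ≠ d0 ∧ c d ∩ K = Q) := by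
    intro Q
    by_cases hQ : Q ⊆ K ∧ Q.card = 2
    · have := Finset.surj_on_of_inj_on_of_card_le (s := (D.erase a).erase d0) (t := Finset.powersetCard 2 K)
        (fun d _ => c d ∩ K) (by
          intro d hd
          simp only [Finset.mem_erase] at hd
          rw [Finset.mem_powersetCard]
          exact ⟨Finset.inter_subset_right, hK2 d hd.2.2 hd.2.1 hd.1⟩)
        (by
          intro d d' hd hd' he
          simp only [Finset.mem_erase] at hd hd'
          exact hinj d hd.2.2 hd.2.1 hd.1 d' hd'.2.2 hd'.2.1 hd'.1 he)
        (by
          rw [Finset.card_powersetCard, hK5, Finset.card_erase_of_mem (by simp [hd0, had.symm]), Finset.card_erase_of_mem ha, hD12]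
          decide) Q (by rw [Finset.mem_powersetCard]; exact hQ)
      obtain ⟨d, hd, he⟩ := this
      simp only [Finset.mem_erase] at hd
      exact ⟨d, fun _ _ => ⟨hd.2.2, hd.2.1, hd.1, he.symm⟩⟩
    · exact ⟨a, fun h1 h2 => absurd ⟨h1, h2⟩ hQ⟩
  choose dd hdd using hsurj
  refine ⟨D, c0, K, W, a, d0, p, dd, fun Q => c (dd Q) ∩ W, hC.compl hD, h0C, hD12, h08, hK5, hW6, ?_, ?_, c0eq, ?_, ?_, ?_⟩
  · intro y hy
    simp only [hW, Finset.mem_compl, Finset.mem_union, Finset.mem_singleton]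
    tauto
  · ext y
    have h1 : y ∈ K → y ∉ D := fun h => Finset.disjoint_left.1 hKD h
    simp only [hW, Finset.mem_compl, Finset.mem_insert, Finset.mem_union, Finset.mem_singleton]
    by_cases hy : y = p
    · subst hy; tauto
    · tauto
  · intro y hy
    by_cases h1 : y = a
    · exact Or.inl h1
    by_cases h2 : y = d0
    · exact Or.inr (Or.inl h2)
    have h3 := hK2 y hy h1 h2
    obtain ⟨g1, g2, g3, g4⟩ := hdd (c y ∩ K) Finset.inter_subset_right h3
    exact Or.inr (Or.inr ⟨c y ∩ K, Finset.inter_subset_right, h3, hinj _ g1 g2 g3 _ hy h1 h2 g4⟩)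
  · intro Q hQ hQ2
    obtain ⟨g1, g2, g3, g4⟩ := hdd Q hQ hQ2
    obtain ⟨f1, f2, f3, f4⟩ := hc _ g1 g2
    refine ⟨?_, Finset.inter_subset_right, ?_⟩
    · convert f1 using 1
      have h1 : ∀ y, y ∈ c (dd Q) ∧ y ∈ D ↔ y = a ∨ y = dd Q := by
        intro y; rw [← Finset.mem_inter, f3]; simp
      ext y
      have h2 := h1 y
      have h3 : y ∈ c (dd Q) ∧ y ∈ K ↔ y ∈ Q := by rw [← Finset.mem_inter, g4]
      simp only [hW, Finset.mem_union, Finset.mem_insert, Finset.mem_singleton, Finset.mem_inter, Finset.mem_compl]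
      by_cases hy : y = p
      · subst hy; tauto
      · tauto
    · have := hself _ g1 g2
      rw [g4] at this
      dsimp only
      omega
  · intro Q hQ hQ2 Q' hQ' hQ2' hne
    obtain ⟨g1, g2, g3, g4⟩ := hdd Q hQ hQ2
    obtain ⟨g1', g2', g3', g4'⟩ := hdd Q' hQ' hQ2'
    have := hmeet _ g1 g2 _ g1' g2' (by intro h; apply hne; rw [← g4, ← g4', h])
    have e1 : c (dd Q) ∩ K ∩ c (dd Q') = Q ∩ Q' := by
      conv_rhs => rw [← g4, ← g4']
      ext y; simp only [Finset.mem_inter]; tauto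
    have e2 : c (dd Q) ∩ W ∩ c (dd Q') = c (dd Q) ∩ W ∩ (c (dd Q') ∩ W) := by
      ext y; simp only [Finset.mem_inter]; tauto
    rw [e1, e2] at this
    dsimp only
    omega
end Golay2

section Golay3
variable {C : Finset (Fin 24) → Prop}

def gens : List (Finset (Fin 24)) :=
  [{12,13,14,15,16,17,18,19,20,21,22,23}, {0,1,12,13,14,15,16,17},
   {0,2,12,13,14,18,19,20}, {0,3,12,13,15,18,21,23}, {0,4,12,13,16,19,22,23}, {0,5,12,13,17,20,21,22},
   {0,6,12,14,15,20,22,23}, {0,7,12,14,16,18,21,22}, {0,8,12,14,17,19,21,23},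
   {0,9,12,15,16,19,20,21}, {0,10,12,15,17,18,19,22}, {0,11,12,16,17,18,20,23}]

theorem IsGolay.std (hC : IsGolay C) : ∃ q : Equiv.Perm (Fin 24), ∀ s ∈ gens, C (s.image q) := by
  obtain ⟨D, c0, K, W, a, d0, p, dd, T, hD, h0, hD12, h08, hK5, hW6, hcov, hDeq, c0eq, hdd, hT, hTT⟩ := hC.struct
  have hD12c : Dᶜ.card = 12 := by
    have : D.card + Dᶜ.card = 24 := by rw [Finset.card_add_card_compl]; rfl
    omega
  obtain ⟨x, hx, hxK⟩ : ∃ x : Fin 5 → Fin 24, Function.Injective x ∧ ∀ y, y ∈ K ↔ ∃ i, x i = y := by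
    refine ⟨fun i => K.orderEmbOfFin hK5 i, (K.orderEmbOfFin hK5).injective, fun y => ?_⟩
    have h1 : y ∈ Set.range (K.orderEmbOfFin hK5) ↔ y ∈ K := by rw [Finset.range_orderEmbOfFin]; rfl
    exact h1.symm
  have hQ : ∀ i j, i ≠ j → ({x i, x j} : Finset (Fin 24)) ⊆ K ∧ ({x i, x j} : Finset (Fin 24)).card = 2 := by
    intro i j hij
    refine ⟨?_, Finset.card_pair (fun h => hij (hx h))⟩
    intro y hy
    simp only [Finset.mem_insert, Finset.mem_singleton] at hy
    rcases hy with rfl | rfl <;> exact (hxK _).2 ⟨_, rfl⟩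
  have him : ∀ i j, ({x i, x j} : Finset (Fin 24)) = ({i, j} : Finset (Fin 5)).image x := by intro i j; simp
  have hTT' : ∀ i j k l, i ≠ j → k ≠ l → ({i, j} : Finset (Fin 5)) ≠ {k, l} → 
      (T {x i, x j} ∩ T {x k, x l}).card + (({i, j} : Finset (Fin 5)) ∩ {k, l}).card = 2 := by
    intro i j k l hij hkl hne
    have := hTT _ (hQ i j hij).1 (hQ i j hij).2 _ (hQ k l hkl).1 (hQ k l hkl).2 (by
      rw [him, him]; intro h; exact hne (Finset.image_injective hx h))
    rw [him i j, him k l, ← Finset.image_inter _ _ hx, Finset.card_image_of_injective _ hx, ← him, ← him] at this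
    exact this
  obtain ⟨σ, w, hwW, hστ⟩ := label3 W hW6 (fun i j => T {x i, x j}) (fun i j => by simp only [Finset.pair_comm])
    (fun i j h => (hT _ (hQ i j h).1 (hQ i j h).2).2.1) (fun i j h => (hT _ (hQ i j h).1 (hQ i j h).2).2.2)
    (fun i j k h1 h2 h3 => by
      have := hTT' i j i k h1 h2 (by revert i j k; decide)
      have e : (({i, j} : Finset (Fin 5)) ∩ {i, k}).card = 1 := by clear this; revert i j k; decide
      omega)
    (fun i j k l h1 h2 h3 h4 h5 h6 => by
      have := hTT' i j k l h1 h6 (by revert i j k l; decide)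
      have e : (({i, j} : Finset (Fin 5)) ∩ {k, l}).card = 0 := by
        rw [Finset.card_eq_zero, ← Finset.disjoint_iff_inter_eq_empty]
        simp [h2, h3, h4, h5, Ne.symm h2, Ne.symm h3, Ne.symm h4, Ne.symm h5]
      omega)
  have hoct : ∀ i j, i < j → C ({a, dd {x (σ i), x (σ j)}, p} ∪ {x (σ i), x (σ j)} ∪ (Tstd i j).image w) := by
    intro i j hij
    have hne : σ i ≠ σ j := fun h => hij.ne (σ.injective h)
    rw [← hστ i j hij]
    exact (hT _ (hQ _ _ hne).1 (hQ _ _ hne).2).1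
  let q : Fin 24 → Fin 24 := ![a, d0, dd {x (σ 0), x (σ 1)}, dd {x (σ 0), x (σ 2)}, dd {x (σ 0), x (σ 3)}, dd {x (σ 0), x (σ 4)},
    dd {x (σ 1), x (σ 2)}, dd {x (σ 1), x (σ 3)}, dd {x (σ 1), x (σ 4)}, dd {x (σ 2), x (σ 3)}, dd {x (σ 2), x (σ 4)}, dd {x (σ 3), x (σ 4)},
    p, x (σ 0), x (σ 1), x (σ 2), x (σ 3), x (σ 4), w 0, w 1, w 2, w 3, w 4, w 5]
  have hqx : ∀ i : Fin 5, ∃ n : Fin 24, n ∈ ({13,14,15,16,17} : Finset (Fin 24)) ∧ q n = x (σ i) := by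
    intro i; fin_cases i
    exacts [⟨13, by decide, rfl⟩, ⟨14, by decide, rfl⟩, ⟨15, by decide, rfl⟩, ⟨16, by decide, rfl⟩, ⟨17, by decide, rfl⟩]
  have hqw : ∀ i : Fin 6, ∃ n : Fin 24, n ∈ ({18,19,20,21,22,23} : Finset (Fin 24)) ∧ q n = w i := by
    intro i; fin_cases i
    exacts [⟨18, by decide, rfl⟩, ⟨19, by decide, rfl⟩, ⟨20, by decide, rfl⟩, ⟨21, by decide, rfl⟩, ⟨22, by decide, rfl⟩, ⟨23, by decide, rfl⟩]
  have hKx : ∀ y ∈ K, ∃ n : Fin 24, n ∈ ({13,14,15,16,17} : Finset (Fin 24)) ∧ q n = y := by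
    intro y hy
    obtain ⟨i, rfl⟩ := (hxK y).1 hy
    obtain ⟨j, rfl⟩ := σ.surjective i
    exact hqx j
  have hqd : ∀ i j, i < j → ∃ n, q n = dd {x (σ i), x (σ j)} := by
    intro i j hij
    fin_cases i <;> fin_cases j <;> first | exact absurd hij (by decide) | skip
    exacts [⟨2, rfl⟩, ⟨3, rfl⟩, ⟨4, rfl⟩, ⟨5, rfl⟩, ⟨6, rfl⟩, ⟨7, rfl⟩, ⟨8, rfl⟩, ⟨9, rfl⟩, ⟨10, rfl⟩, ⟨11, rfl⟩]
  have hsurj : Function.Surjective q := by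
    intro y
    by_cases hy : y ∈ D
    · rcases hdd y hy with rfl | rfl | ⟨Q, hQK, hQ2, rfl⟩
      · exact ⟨0, rfl⟩
      · exact ⟨1, rfl⟩
      · obtain ⟨u, v, huv, rfl⟩ := Finset.card_eq_two.1 hQ2
        obtain ⟨i, rfl⟩ := (hxK u).1 (hQK (by simp))
        obtain ⟨j, rfl⟩ := (hxK v).1 (hQK (by simp))
        obtain ⟨i, rfl⟩ := σ.surjective i
        obtain ⟨j, rfl⟩ := σ.surjective j
        rcases lt_trichotomy i j with h | h | h
        · exact hqd i j h
        · exact absurd (by rw [h]) huv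
        · rw [Finset.pair_comm]; exact hqd j i h
    · rcases hcov y hy with rfl | h | h
      · exact ⟨12, rfl⟩
      · obtain ⟨n, -, h⟩ := hKx y h
        exact ⟨n, h⟩
      · obtain ⟨i, rfl⟩ := hwW y h
        obtain ⟨n, -, h⟩ := hqw i
        exact ⟨n, h⟩
  have hbij : Function.Bijective q := ⟨Finite.injective_iff_surjective.2 hsurj, hsurj⟩
  refine ⟨Equiv.ofBijective q hbij, ?_⟩
  rw [Equiv.coe_ofBijective]
  have e1 : C (Finset.image q {12,13,14,15,16,17,18,19,20,21,22,23}) := by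
    have : Dᶜ = Finset.image q {12,13,14,15,16,17,18,19,20,21,22,23} := by
      apply Finset.eq_of_subset_of_card_le
      · rw [hDeq]
        intro y hy
        simp only [Finset.mem_insert, Finset.mem_union] at hy
        rw [Finset.mem_image]
        rcases hy with rfl | h | h
        · exact ⟨12, by decide, rfl⟩
        · obtain ⟨n, hn, h⟩ := hKx y h
          exact ⟨n, by clear h; revert n; decide, h⟩
        · obtain ⟨i, rfl⟩ := hwW y h
          obtain ⟨n, hn, h⟩ := hqw i
          exact ⟨n, by clear h; revert n; decide, h⟩
      · rw [hD12c]; exact Finset.card_image_le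
    rw [← this]; exact hD
  have e2 : C (Finset.image q {0,1,12,13,14,15,16,17}) := by
    have : c0 = Finset.image q {0,1,12,13,14,15,16,17} := by
      apply Finset.eq_of_subset_of_card_le
      · rw [c0eq]
        intro y hy
        simp only [Finset.mem_insert, Finset.mem_union, Finset.mem_singleton] at hy
        rw [Finset.mem_image]
        rcases hy with (rfl | rfl | rfl) | h
        · exact ⟨0, by decide, rfl⟩
        · exact ⟨1, by decide, rfl⟩
        · exact ⟨12, by decide, rfl⟩
        · obtain ⟨n, hn, h⟩ := hKx y h
          exact ⟨n, by clear h; revert n; decide, h⟩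
      · rw [h08]; exact Finset.card_image_le
    rw [← this]; exact h0
  have key : ∀ i j s, i < j → Finset.image q s = {a, dd {x (σ i), x (σ j)}, p} ∪ {x (σ i), x (σ j)} ∪ (Tstd i j).image w → C (Finset.image q s) := by
    intro i j s hij h
    rw [h]; exact hoct i j hij
  have hT01 : Tstd 0 1 = {0,1,2} := rfl
  have hT02 : Tstd 0 2 = {0,3,5} := rfl
  have hT03 : Tstd 0 3 = {1,4,5} := rfl
  have hT04 : Tstd 0 4 = {2,3,4} := rfl
  have hT12 : Tstd 1 2 = {2,4,5} := rfl
  have hT13 : Tstd 1 3 = {0,3,4} := rfl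
  have hT14 : Tstd 1 4 = {1,3,5} := rfl
  have hT23 : Tstd 2 3 = {1,2,3} := rfl
  have hT24 : Tstd 2 4 = {0,1,4} := rfl
  have hT34 : Tstd 3 4 = {0,2,5} := rfl
  intro s hs
  simp only [gens, List.mem_cons, List.not_mem_nil, or_false] at hs
  rcases hs with rfl | rfl | rfl | rfl | rfl | rfl | rfl | rfl | rfl | rfl | rfl | rfl
  · exact e1
  · exact e2
  · apply key 0 1 _ (by decide); rw [hT01]; simp only [Finset.image_insert, Finset.image_singleton, Finset.insert_union, Finset.singleton_union]; rfl
  · apply key 0 2 _ (by decide); rw [hT02]; simp only [Finset.image_insert, Finset.image_singleton, Finset.insert_union, Finset.singleton_union]; rfl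
  · apply key 0 3 _ (by decide); rw [hT03]; simp only [Finset.image_insert, Finset.image_singleton, Finset.insert_union, Finset.singleton_union]; rfl
  · apply key 0 4 _ (by decide); rw [hT04]; simp only [Finset.image_insert, Finset.image_singleton, Finset.insert_union, Finset.singleton_union]; rfl
  · apply key 1 2 _ (by decide); rw [hT12]; simp only [Finset.image_insert, Finset.image_singleton, Finset.insert_union, Finset.singleton_union]; rfl
  · apply key 1 3 _ (by decide); rw [hT13]; simp only [Finset.image_insert, Finset.image_singleton, Finset.insert_union, Finset.singleton_union]; rfl
  · apply key 1 4 _ (by decide); rw [hT14]; simp only [Finset.image_insert, Finset.image_singleton, Finset.insert_union, Finset.singleton_union]; rfl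
  · apply key 2 3 _ (by decide); rw [hT23]; simp only [Finset.image_insert, Finset.image_singleton, Finset.insert_union, Finset.singleton_union]; rfl
  · apply key 2 4 _ (by decide); rw [hT24]; simp only [Finset.image_insert, Finset.image_singleton, Finset.insert_union, Finset.singleton_union]; rfl
  · apply key 3 4 _ (by decide); rw [hT34]; simp only [Finset.image_insert, Finset.image_singleton, Finset.insert_union, Finset.singleton_union]; rfl
end Golay3

section Final

def El : List (List ℤ) :=
  [[-3,1,1,1,1,1,1,1,1,1,1,1,1,1,1,1,1,1,1,1,1,1,1,1],
   [0,0,0,0,0,0,0,0,0,0,0,0,2,2,2,2,2,2,2,2,2,2,2,2],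
   [2,2,0,0,0,0,0,0,0,0,0,0,2,2,2,2,2,2,0,0,0,0,0,0],
   [2,0,2,0,0,0,0,0,0,0,0,0,2,2,2,0,0,0,2,2,2,0,0,0],
   [2,0,0,2,0,0,0,0,0,0,0,0,2,2,0,2,0,0,2,0,0,2,0,2],
   [2,0,0,0,2,0,0,0,0,0,0,0,2,2,0,0,2,0,0,2,0,0,2,2],
   [2,0,0,0,0,2,0,0,0,0,0,0,2,2,0,0,0,2,0,0,2,2,2,0],
   [2,0,0,0,0,0,2,0,0,0,0,0,2,0,2,2,0,0,0,0,2,0,2,2],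
   [2,0,0,0,0,0,0,2,0,0,0,0,2,0,2,0,2,0,2,0,0,2,2,0],
   [2,0,0,0,0,0,0,0,2,0,0,0,2,0,2,0,0,2,0,2,0,2,0,2],
   [2,0,0,0,0,0,0,0,0,2,0,0,2,0,0,2,2,0,0,2,2,2,0,0],
   [2,0,0,0,0,0,0,0,0,0,2,0,2,0,0,2,0,2,2,2,0,0,2,0],
   [2,0,0,0,0,0,0,0,0,0,0,2,2,0,0,0,2,2,2,0,2,0,0,2]]

def Vl : List (List ℤ) :=
  [[1,1,-1,1,-1,-1,1,3,1,-1,-1,1,1,-1,1,1,-1,1,-1,1,-1,-1,1,-1],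
   [-1,1,-1,1,1,-1,-1,-1,1,1,-1,1,1,-1,-3,-1,1,-1,1,-1,1,-1,-1,1],
   [0,-2,0,-2,0,0,0,0,-2,0,0,-2,0,0,0,0,0,-2,0,-2,-2,0,0,-2],
   [-1,-1,1,1,-1,-1,-1,-1,1,-1,-1,1,-3,1,1,-1,-1,1,-1,1,1,1,1,-1],
   [2,2,0,0,-2,2,0,2,2,0,0,0,0,0,0,0,0,0,0,-2,0,0,0,2],
   [0,0,0,0,0,-2,2,-2,-2,0,0,0,2,0,0,0,0,-2,0,0,2,0,0,2],
   [0,0,-2,0,0,2,0,-2,0,0,0,-2,0,0,0,0,0,0,-2,2,-2,0,0,-2],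
   [1,-3,1,1,1,1,-1,1,1,1,-1,1,-1,-1,1,-1,-1,1,1,1,1,-1,-1,1],
   [-1,1,1,-3,-1,1,-1,1,-1,1,1,1,1,1,-1,1,1,1,-1,-1,1,1,-1,1],
   [1,1,1,1,-1,-3,1,-1,-1,1,1,-1,1,-1,1,1,-1,1,1,1,-1,1,1,-1],
   [-1,1,-1,1,1,1,-1,-1,1,-3,-1,-1,-1,-1,-1,1,1,1,1,1,-1,-1,-1,1],
   [1,-1,-1,-1,1,1,1,1,-1,1,1,1,-1,1,1,-1,1,-1,3,-1,1,-1,-1,-1],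
   [-2,0,2,0,2,0,0,0,0,0,2,0,0,2,0,0,0,0,-2,0,0,2,2,0],
   [1,1,-1,1,-1,-1,-1,1,3,-1,-1,-1,1,-1,-1,-1,-1,1,-1,-1,-1,-1,1,1],
   [1,-1,-1,-1,-1,-1,-1,-1,-1,-1,-1,1,1,-1,-1,-1,1,-3,1,-1,1,-1,-1,1],
   [-1,-1,-1,-1,-1,1,-1,-3,-1,1,1,-1,-1,1,1,-1,-1,-1,-1,-1,-1,1,1,-1],
   [1,-1,1,1,-1,1,-1,1,1,-1,-1,-1,-1,-1,3,-1,-1,1,-1,1,1,1,1,1],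
   [0,2,0,0,-2,2,0,0,0,0,0,2,2,0,0,0,0,0,0,0,2,0,-2,2],
   [0,0,0,0,0,0,2,-2,-2,2,2,-2,2,-2,0,0,0,0,0,0,0,0,0,0],
   [-1,-1,1,1,1,1,-1,-1,-1,-1,-1,-1,-1,-1,1,1,1,1,-1,3,-1,-1,-1,-1],
   [0,0,0,0,0,2,0,2,0,2,0,2,-2,0,0,0,0,2,2,0,0,0,-2,0],
   [-1,1,3,-1,1,-1,1,1,-1,1,1,-1,1,1,-1,1,1,1,1,-1,1,1,1,1],
   [0,2,0,0,0,-2,2,0,0,-2,0,0,0,0,0,2,0,0,0,2,-2,0,0,-2],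
   [0,0,-2,2,2,0,0,0,2,0,0,0,-2,0,-2,0,0,0,2,0,0,-2,0,0],
   [0,-2,0,-2,2,0,0,2,0,0,0,0,0,2,0,0,2,-2,0,-2,0,0,0,0],
   [0,0,0,0,0,-2,0,0,0,0,0,2,0,2,0,0,-2,0,-2,0,0,2,2,-2]]

def Wl : List (List ℤ) :=
  [[-1,-1,-1,-1,-1,1,1,-1,1,1,-3,1,1,-1,1,3,1,1,1,-1,1,-1,3,-1],
   [0,2,0,-2,2,0,0,-2,2,2,-4,0,0,-2,2,2,0,0,0,-2,2,0,0,-2],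
   [0,0,0,0,0,0,0,0,0,0,-2,-2,0,0,0,2,-2,0,0,-2,2,0,-2,-2],
   [0,-2,0,0,-2,0,2,-2,2,0,-2,0,0,0,0,2,2,2,0,-2,2,0,0,-2],
   [3,1,1,-1,1,1,1,-3,1,1,-3,1,-1,-1,1,3,1,1,-1,-3,1,-1,1,-1],
   [1,1,-1,-1,1,-1,1,-1,-1,1,-3,-1,-1,1,1,1,-1,1,-1,-1,1,-1,-1,1],
   [1,-1,-1,-1,-1,1,1,-1,1,1,-3,-1,1,1,-1,1,1,1,1,1,1,1,1,-1],
   [1,-1,1,-3,1,1,1,-3,3,1,-3,1,1,-1,1,3,-1,1,1,-1,1,-1,1,-1],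
   [1,1,-1,-3,1,-1,-1,-1,1,1,-1,-1,-1,-1,1,3,-1,1,-1,-1,3,-1,-1,-1],
   [1,-1,-1,1,-1,-1,-1,-1,1,1,-1,-1,1,1,1,3,1,1,1,-1,1,1,-1,-1],
   [1,-1,-1,-1,1,1,1,-3,1,-1,-3,1,1,-1,1,3,1,3,1,-3,1,1,1,-1],
   [2,2,0,-2,2,0,0,-2,0,0,-2,0,0,0,2,0,0,2,0,-2,2,-2,0,-2],
   [-2,0,0,0,-2,-2,0,2,0,0,2,-2,0,2,0,-4,0,0,0,2,-2,-2,-2,2],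
   [-2,-2,0,0,-4,0,0,2,0,0,2,0,0,0,-2,-2,2,-2,2,4,-2,0,2,2],
   [-4,0,0,-2,-2,0,0,0,2,2,0,0,0,0,2,0,0,-2,2,2,-2,-2,2,2],
   [-3,1,-1,-1,-1,-1,-1,3,1,1,1,-3,-1,-1,1,-1,-1,-3,1,3,1,1,-1,1],
   [-4,-2,0,2,-4,0,0,2,2,0,2,-2,2,2,0,0,0,-2,2,2,0,0,-2,0],
   [-2,-2,0,0,-2,0,2,0,2,0,2,0,0,-2,0,0,2,0,0,0,0,0,0,0],
   [-1,1,1,1,-1,-1,-1,1,-1,1,1,-1,-1,1,1,-1,1,-1,-1,1,-1,-3,-1,1],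
   [-3,-1,-1,1,-3,-1,1,3,-1,1,1,-1,-1,1,-1,-3,1,-1,1,3,-3,1,-1,3],
   [-3,-1,1,-1,-3,1,1,1,1,1,-1,-1,1,1,-1,-1,1,-1,3,3,-1,-1,3,1],
   [-3,1,1,-3,-1,-1,1,1,3,1,1,-1,-1,-1,1,-1,-1,-3,1,3,-1,-1,-1,1],
   [-3,-1,-1,1,-3,-1,-1,3,1,1,3,-3,-1,1,-1,1,-1,-3,1,3,1,-1,-1,1],
   [-3,-3,-1,1,-3,-1,1,1,3,1,1,-1,1,1,1,1,3,-1,1,1,-1,1,-1,1]]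

def vec (l : List ℤ) : Fin 24 → ℤ := fun i => l.getD i 0

def ldot : List ℤ → List ℤ → ℤ
  | x :: l, y :: m => x * y + ldot l m
  | _, _ => 0

theorem ldot_eq (n : ℕ) : ∀ l m : List ℤ, l.length = n → m.length = n → ∑ i : Fin n, l.getD i 0 * m.getD i 0 = ldot l m := by
  induction n with
  | zero => intro l m hl hm; rw [List.length_eq_zero_iff] at hl; subst hl; simp [ldot]
  | succ n ih =>
    intro l m hl hm
    match l, m, hl, hm with
    | x :: l, y :: m, hl, hm =>
      rw [Fin.sum_univ_succ]
      have := ih l m (by simpa using hl) (by simpa using hm)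
      simp only [ldot, ← this]
      simp

theorem lsum_eq (n : ℕ) : ∀ l : List ℤ, l.length = n → ∑ i : Fin n, l.getD i 0 = l.sum := by
  induction n with
  | zero => intro l hl; rw [List.length_eq_zero_iff] at hl; subst hl; simp
  | succ n ih =>
    intro l hl
    match l, hl with
    | x :: l, hl =>
      rw [Fin.sum_univ_succ]
      have := ih l (by simpa using hl)
      simp only [List.sum_cons, ← this]
      simp

/-- `l + n e` -/
def axpy (n : ℤ) (e l : List ℤ) : List ℤ := List.zipWith (fun x y => n * x + y) e l

theorem vec_axpy (n : ℤ) (e l : List ℤ) (he : e.length = 24) (hl : l.length = 24) : vec (axpy n e l) = n • vec e + vec l := by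
  ext i
  have h1 : (i : ℕ) < e.length := by omega
  have h2 : (i : ℕ) < l.length := by omega
  have h3 : (i : ℕ) < (axpy n e l).length := by simp [axpy]; omega
  simp only [vec, Pi.add_apply, Pi.smul_apply, smul_eq_mul]
  rw [List.getD_eq_getElem _ _ h1, List.getD_eq_getElem _ _ h2, List.getD_eq_getElem _ _ h3]
  simp [axpy]

def comb : List ℤ → List (List ℤ) → List ℤ → List ℤ
  | n :: ns, e :: es, l => axpy n e (comb ns es l)
  | _, _, l => l

def cert (v : List ℤ) : List ℤ :=
  let m := v.getD 0 0 % 2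
  let b : List ℤ := ((v.drop 1).take 11).map (fun x => ((x - m) / 2) % 2)
  m :: (((v.getD 12 0 - m) / 2 + b.sum) % 2) :: b

def chk (v : List ℤ) : Prop :=
  v.length = 24 ∧ (comb ((cert v).map (fun x => -x)) El v).length = 24 ∧ (∀ x ∈ comb ((cert v).map (fun x => -x)) El v, 4 ∣ x) ∧
    8 ∣ (comb ((cert v).map (fun x => -x)) El v).sum ∧ comb (cert v) El (comb ((cert v).map (fun x => -x)) El v) = v

instance (v : List ℤ) : Decidable (chk v) := by unfold chk; infer_instance

theorem Vl_chk : ∀ v ∈ Vl, chk v := by decide +kernel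

theorem Wl_chk : ∀ v ∈ Wl, chk v := by decide +kernel

def V (a : Fin 2) (k : Fin 13) : List ℤ := Vl.getD (13 * a + k) []

theorem V_mem : ∀ a k, V a k ∈ Vl := by decide +kernel

theorem V_gram : ∀ a b i j, ldot (V a (i + 1)) (V b (j + 1)) = ldot (V a i) (V b j) := by decide +kernel

theorem V_sum : ∀ a, ∀ i : Fin 24, ((List.finRange 13).map (fun k => (V a k).getD i 0)).sum = 0 := by decide +kernel

def W (a : Fin 2) (k : Fin 12) : List ℤ := Wl.getD (12 * a + k) []

theorem W_mem : ∀ a k, W a k ∈ Wl := by decide +kernel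

theorem WV : ∀ a k b l, ldot (W a k) (V b (Fin.castSucc l)) = if a = b ∧ k = l then 8 else 0 := by decide +kernel

theorem El_len : ∀ e ∈ El, e.length = 24 := by decide +kernel

theorem El_spec : ∀ e ∈ El, (∀ i, vec e i = if i = 0 then -3 else 1) ∨ ∃ s ∈ gens, ∀ i, vec e i = if i ∈ s then 2 else 0 := by
  decide +kernel

variable {Λ : Type*} [AddCommGroup Λ] {B : Λ →ₗ[ℤ] Λ →ₗ[ℤ] ℤ}

theorem comb_mem {c : Λ →+ (Fin 24 → ℤ)} : ∀ (es : List (List ℤ)) (_ : ∀ e ∈ es, e.length = 24 ∧ ∃ x, c x = vec e) (ns l : List ℤ)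
    (_ : l.length = 24 ∧ ∃ x, c x = vec l), (comb ns es l).length = 24 ∧ ∃ x, c x = vec (comb ns es l) := by
  intro es
  induction es with
  | nil => intro _ ns l hl; cases ns <;> exact hl
  | cons e es ih =>
    intro hes ns l hl
    cases ns with
    | nil => exact hl
    | cons n ns =>
      obtain ⟨h1, x, hx⟩ := ih (fun e he => hes e (List.mem_cons_of_mem _ he)) ns l hl
      obtain ⟨h2, y, hy⟩ := hes e List.mem_cons_self
      refine ⟨by simp [comb, axpy, h1, h2], n • y + x, ?_⟩
      rw [comb, vec_axpy _ _ _ h2 h1, map_add, map_zsmul, hx, hy]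

theorem chk_mem {c : Λ →+ (Fin 24 → ℤ)} (hc : Coord B c) (hE : ∀ e ∈ El, e.length = 24 ∧ ∃ x, c x = vec e) (v : List ℤ) (hv : chk v) :
    ∃ x, c x = vec v := by
  obtain ⟨-, h1, h2, h3, h4⟩ := hv
  have h5 : ∃ x, c x = vec (comb ((cert v).map (fun x => -x)) El v) := by
    apply hc.four
    · intro i
      have h : (i : ℕ) < (comb ((cert v).map (fun x => -x)) El v).length := by omega
      rw [vec, List.getD_eq_getElem _ _ h]
      exact h2 _ (List.getElem_mem h)
    · have := lsum_eq 24 _ h1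
      rw [← this] at h3
      exact h3
  have := (comb_mem El hE (cert v) _ ⟨h1, h5⟩).2
  rwa [h4] at this

theorem basis_of_dual [Module.Free ℤ Λ] [Module.Finite ℤ Λ] (hrank : finrank ℤ Λ = 24) (v w : Fin 2 × Fin 12 → Λ)
    (h : ∀ r s, B (w r) (v s) = if r = s then 1 else 0) : ∃ b : Basis (Fin 2 × Fin 12) ℤ Λ, ∀ r, b r = v r := by
  let g : Λ →ₗ[ℤ] (Fin 2 × Fin 12 → ℤ) := LinearMap.pi (fun r => B (w r))
  have hg : ∀ s, g (v s) = Pi.single s 1 := by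
    intro s; ext r; simp [g, h, Pi.single_apply]
  have hsurj : Function.Surjective g := by
    intro y
    refine ⟨∑ s, y s • v s, ?_⟩
    rw [map_sum]
    ext r
    simp [hg, Pi.single_apply, Finset.sum_apply]
  have e : (Fin 2 × Fin 12 → ℤ) ≃ₗ[ℤ] Λ := LinearEquiv.ofFinrankEq _ _ (by rw [hrank]; simp)
  have hinj : Function.Injective g := by
    have h1 : Function.Injective (e.toLinearMap ∘ₗ g) :=
      OrzechProperty.injective_of_surjective_endomorphism _ (by
        rw [LinearMap.coe_comp]; exact e.surjective.comp hsurj)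
    rw [LinearMap.coe_comp] at h1
    exact h1.of_comp
  have hbij : Function.Bijective g := ⟨hinj, hsurj⟩
  refine ⟨Basis.ofEquivFun (LinearEquiv.ofBijective g hbij), fun r => ?_⟩
  rw [Basis.coe_ofEquivFun, LinearEquiv.symm_apply_eq, LinearEquiv.ofBijective_apply, hg]

theorem vectors [Module.Free ℤ Λ] [Module.Finite ℤ Λ] (hB : IsLeech B) (hrank : finrank ℤ Λ = 24) :
    ∃ u : Fin 2 → Fin 13 → Λ, (∀ a, ∑ k, u a k = 0) ∧ (∀ a b i j, B (u a (i + 1)) (u b (j + 1)) = B (u a i) (u b j)) ∧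
      ∃ b : Basis (Fin 2 × Fin 12) ℤ Λ, ∀ r, b r = u r.1 (Fin.castSucc r.2) := by
  obtain ⟨c0, hc0, x0, hx0⟩ := coord_norm hB hrank
  have hG := code_golay hB hc0 hx0
  obtain ⟨q, hq⟩ := hG.std
  have hc := hc0.twist (fun _ => 1) (fun _ => Or.inl rfl) q
  obtain ⟨c, hcc⟩ : ∃ c : Λ →+ (Fin 24 → ℤ), c = AddMonoidHom.mk' (fun x i => (1:ℤ) * c0 x (q i)) (fun x y => by ext i; simp) := ⟨_, rfl⟩
  rw [← hcc] at hc
  have hcv : ∀ x i, c x i = c0 x (q i) := by intro x i; rw [hcc]; simp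
  have hE : ∀ e ∈ El, e.length = 24 ∧ ∃ x, c x = vec e := by
    intro e he
    refine ⟨El_len e he, ?_⟩
    rcases El_spec e he with h | ⟨s, hs, h⟩
    · obtain ⟨x, hx⟩ := hc.u0 hB (x0 := x0) (fun i => by rw [hcv]; exact hx0 _)
      exact ⟨x, by rw [hx]; ext i; rw [h]⟩
    · obtain ⟨x, hx⟩ := hc0.ind hx0 (hq s hs) (hG.four _ (hq s hs))
      refine ⟨x, ?_⟩
      ext i
      rw [hcv, hx, h]
      simp
  have hV : ∀ a k, ∃ x, c x = vec (V a k) := fun a k => chk_mem hc hE _ (Vl_chk _ (V_mem a k))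
  have hW : ∀ a k, ∃ x, c x = vec (W a k) := fun a k => chk_mem hc hE _ (Wl_chk _ (W_mem a k))
  choose u hu using hV
  choose w hw using hW
  have hdot : ∀ l m x y, l.length = 24 → m.length = 24 → c x = vec l → c y = vec m → 8 * B x y = ldot l m := by
    intro l m x y hl hm hx hy
    rw [← hc.dot, hx, hy, ← ldot_eq 24 l m hl hm]
    rfl
  have lV : ∀ a k, (V a k).length = 24 := fun a k => (Vl_chk _ (V_mem a k)).1
  have lW : ∀ a k, (W a k).length = 24 := fun a k => (Wl_chk _ (W_mem a k)).1
  refine ⟨u, ?_, ?_, ?_⟩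
  · intro a
    have h0 : c (∑ k, u a k) = 0 := by
      ext i
      rw [map_sum, Finset.sum_apply]
      have := V_sum a i
      rw [← List.ofFn_eq_map, List.sum_ofFn] at this
      simp only [hu]
      exact this
    by_contra hne
    have h1 := hB.pos _ hne
    have h2 := hc.dot (∑ k, u a k) (∑ k, u a k)
    rw [h0] at h2
    simp only [Pi.zero_apply, mul_zero, Finset.sum_const_zero] at h2
    omega
  · intro a b i j
    have h1 := hdot _ _ _ _ (lV a (i+1)) (lV b (j+1)) (hu _ _) (hu _ _)
    have h2 := hdot _ _ _ _ (lV a i) (lV b j) (hu _ _) (hu _ _)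
    rw [V_gram, ← h2] at h1
    omega
  · apply basis_of_dual (B := B) hrank (fun r => u r.1 (Fin.castSucc r.2)) (fun r => w r.1 r.2)
    rintro ⟨a, k⟩ ⟨b, l⟩
    have h1 := hdot _ _ _ _ (lW a k) (lV b (Fin.castSucc l)) (hw _ _) (hu _ _)
    rw [WV] at h1
    simp only [Prod.mk.injEq]
    split_ifs at h1 ⊢ <;> omega

theorem isometry [Module.Free ℤ Λ] [Module.Finite ℤ Λ] (hB : IsLeech B) (hrank : finrank ℤ Λ = 24) :
    ∃ φ : Λ ≃ₗ[ℤ] Λ, (∀ x y : Λ, B (φ x) (φ y) = B x y) ∧ orderOf φ = 13 ∧ fixSub φ = ⊥ := by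
  obtain ⟨u, hsum, hgram, b, hb⟩ := vectors hB hrank
  let f : Λ →ₗ[ℤ] Λ := b.constr ℤ (fun r => u r.1 (Fin.castSucc r.2 + 1))
  have hf0 : ∀ a (k : Fin 12), f (u a (Fin.castSucc k)) = u a (Fin.castSucc k + 1) := by
    intro a k
    rw [← hb (a, k), Basis.constr_basis]
  have hlast : ∀ a, u a (Fin.last 12) = - ∑ k : Fin 12, u a (Fin.castSucc k) := by
    intro a
    have := hsum a
    rw [Fin.sum_univ_castSucc] at this
    exact (neg_eq_of_add_eq_zero_right this).symm
  have hf : ∀ a k, f (u a k) = u a (k + 1) := by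
    intro a k
    induction k using Fin.lastCases with
    | cast k => exact hf0 a k
    | last =>
      rw [hlast, map_neg, map_sum]
      simp only [hf0]
      have h2 : ∑ k, u a (k + 1) = 0 := by
        rw [← hsum a]; exact Equiv.sum_comp (Equiv.addRight (1 : Fin 13)) (u a)
      rw [Fin.sum_univ_castSucc] at h2
      exact neg_eq_of_add_eq_zero_right h2
  have hfn : ∀ (n : ℕ) a k, (f ^ n) (u a k) = u a (k + Fin.ofNat 13 n) := by
    intro n
    induction n with
    | zero => intro a k; simp
    | succ n ih =>
      intro a k
      have h : Fin.ofNat 13 (n + 1) = Fin.ofNat 13 n + 1 := by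
        apply Fin.ext; simp [Fin.ofNat, Fin.val_add]
      rw [pow_succ', Module.End.mul_apply, ih, hf, h, add_assoc]
  have h13 : f ^ 13 = 1 := by
    apply b.ext
    intro r
    rw [hb, hfn]
    have h : Fin.ofNat 13 13 = 0 := rfl
    rw [h, add_zero]
    rfl
  have hN : ∀ x, ∑ n ∈ Finset.range 13, (f ^ n) x = 0 := by
    have : (∑ n ∈ Finset.range 13, f ^ n) = 0 := by
      apply b.ext
      intro r
      rw [hb, LinearMap.sum_apply, LinearMap.zero_apply, ← Fin.sum_univ_eq_sum_range (fun n => (f ^ n) (u r.1 r.2.castSucc))]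
      simp only [hfn, Fin.ofNat_val_eq_self]
      rw [← hsum r.1]
      exact Equiv.sum_comp (Equiv.addLeft (r.2.castSucc : Fin 13)) (u r.1)
    intro x
    have h := LinearMap.congr_fun this x
    rwa [LinearMap.sum_apply] at h
  let φ : Λ ≃ₗ[ℤ] Λ := LinearEquiv.ofLinearMap f (f ^ 12)
    (by rw [← Module.End.mul_eq_comp, ← pow_succ', h13]; rfl) (by rw [← Module.End.mul_eq_comp, ← pow_succ, h13]; rfl)
  have hφ : ∀ x, φ x = f x := fun x => rfl
  have hφn : ∀ n x, (φ ^ n) x = (f ^ n) x := by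
    intro n
    induction n with
    | zero => intro x; simp
    | succ n ih => intro x; rw [pow_succ, pow_succ, LinearEquiv.mul_apply, Module.End.mul_apply, ih, hφ]
  have hfix : ∀ x, f x = x → x = 0 := by
    intro x hx
    have h1 : ∀ n, (f ^ n) x = x := by
      intro n
      induction n with
      | zero => simp
      | succ n ih => rw [pow_succ, Module.End.mul_apply, hx, ih]
    have h2 := hN x
    simp only [h1, Finset.sum_const, Finset.card_range] at h2
    have h3 : (13 : ℤ) • x = 0 := by rw [← h2]; norm_cast
    have : IsTorsionFree ℤ Λ := inferInstance
    exact (smul_eq_zero.1 h3).resolve_left (by norm_num)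
  refine ⟨φ, ?_, ?_, ?_⟩
  · have : B.compl₁₂ f f = B := by
      apply b.ext
      intro r
      apply b.ext
      intro s
      rw [LinearMap.compl₁₂_apply, hb, hb, hf, hf, hgram]
    intro x y
    exact LinearMap.congr_fun (LinearMap.congr_fun this x) y
  · have : Fact (Nat.Prime 13) := ⟨by norm_num⟩
    apply orderOf_eq_prime
    · ext x; rw [hφn, h13]; rfl
    · intro h
      have h0 : b (0, 0) = 0 := hfix _ (by rw [← hφ, h]; rfl)
      exact b.ne_zero _ h0
  · rw [eq_bot_iff]
    intro x hx
    rw [fixSub, LinearMap.mem_ker, LinearMap.sub_apply, sub_eq_zero] at hx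
    exact hfix x hx

end Final

end LeechA

/-- the Leech lattice admits an isometry of order 13 without nonzero
fixed vectors. -/
theorem stmt15
    (Λ : Type*) [AddCommGroup Λ] [Module.Free ℤ Λ] [Module.Finite ℤ Λ]
    (bΛ : Λ →ₗ[ℤ] Λ →ₗ[ℤ] ℤ)
    (hsymm : ∀ x y : Λ, bΛ x y = bΛ y x)
    (heven : ∀ x : Λ, Even (bΛ x x))
    (hneg : ∀ x : Λ, x ≠ 0 → bΛ x x < 0)
    (hrank : finrank ℤ Λ = 24)
    (hunimodular : Function.Bijective bΛ)
    (hnoroot : ∀ x : Λ, bΛ x x ≠ -2) :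
    ∃ φ : Λ ≃ₗ[ℤ] Λ,
      (∀ x y : Λ, bΛ (φ x) (φ y) = bΛ x y) ∧
      orderOf φ = 13 ∧
      fixSub φ = ⊥ := by
  have hB : LeechA.IsLeech (-bΛ) := by
    refine ⟨fun x y => ?_, fun x => ?_, fun x hx => ?_, ?_, fun x h => ?_⟩
    · rw [LinearMap.neg_apply, LinearMap.neg_apply, LinearMap.neg_apply, LinearMap.neg_apply, hsymm x y]
    · rw [LinearMap.neg_apply, LinearMap.neg_apply]
      exact (heven x).neg
    · rw [LinearMap.neg_apply, LinearMap.neg_apply]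
      exact neg_pos.2 (hneg x hx)
    · exact (Equiv.neg (Λ →ₗ[ℤ] ℤ)).bijective.comp hunimodular
    · rw [LinearMap.neg_apply, LinearMap.neg_apply] at h
      exact hnoroot x (by omega)
  obtain ⟨φ, h1, h2, h3⟩ := LeechA.isometry hB hrank
  refine ⟨φ, fun x y => ?_, h2, h3⟩
  have h := h1 x y
  rw [LinearMap.neg_apply, LinearMap.neg_apply, LinearMap.neg_apply, LinearMap.neg_apply] at h
  exact neg_injective h
end

section
/- Let M be the rank-4 even negative definite lattice with Gram matrix [[−4,−1,−1,1],[−1,−4,1,−1],[−1,1,−4,−1],[1,−1,−1,−4]]. Then the orthogonal direct sum M ⊕ M admits an embedding as a finite-index sublattice of E8(−1); equivalently, M ⊕ M has an even unimodular negative definite overlattice of rank 8. -/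
open Matrix

/-- The E8 Cartan matrix (Bourbaki numbering), the Gram matrix of the positive
definite even unimodular lattice `E8`. -/
def E8M : Matrix (Fin 8) (Fin 8) ℤ :=
  !![2,0,-1,0,0,0,0,0;
     0,2,0,-1,0,0,0,0;
     -1,0,2,-1,0,0,0,0;
     0,-1,-1,2,-1,0,0,0;
     0,0,0,-1,2,-1,0,0;
     0,0,0,0,-1,2,-1,0;
     0,0,0,0,0,-1,2,-1;
     0,0,0,0,0,0,-1,2]

/-- The bilinear form of `E8(-1)`. -/
def bE8neg (x y : Fin 8 → ℤ) : ℤ := -(x ⬝ᵥ (E8M *ᵥ y))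

/-- The Gram matrix of the rank-4 negative definite lattice `M`. -/
def M5n : Matrix (Fin 4) (Fin 4) ℤ :=
  !![-4,-1,-1,1; -1,-4,1,-1; -1,1,-4,-1; 1,-1,-1,-4]

/-- The bilinear form of the lattice `M`. -/
def bM5 (x y : Fin 4 → ℤ) : ℤ := x ⬝ᵥ (M5n *ᵥ y)


def B1 : Matrix (Fin 8) (Fin 4) ℤ :=
  !![1,0,-1,-1;
     1,1,-3,-1;
     1,-1,-3,-2;
     3,0,-5,-3;
     3,0,-3,-2;
     3,0,-2,-2;
     2,0,-1,0;
     1,0,0,0]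

def B2 : Matrix (Fin 8) (Fin 4) ℤ :=
  !![-2,-2,0,2;
     -3,-3,1,2;
     -4,-4,1,3;
     -6,-5,1,4;
     -5,-4,2,4;
     -3,-4,2,2;
     -2,-3,1,1;
     -2,-2,0,0]

def C1 : Matrix (Fin 4) (Fin 8) ℤ :=
  !![0,-2,-2,2,0,0,2,-1;
     2,3,-2,-1,0,1,-2,1;
     2,0,0,-2,1,1,-2,2;
     -1,0,0,0,1,-3,4,-1]

def C2 : Matrix (Fin 4) (Fin 8) ℤ :=
  !![2,0,0,0,-2,1,2,-3;
     -2,-1,-1,1,2,-1,-1,0;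
     -3,1,1,-2,2,1,-1,0;
     3,0,0,-1,1,-1,1,-2]

theorem hB11 : B1ᵀ * E8M * B1 = -M5n := by decide
theorem hB22 : B2ᵀ * E8M * B2 = -M5n := by decide
theorem hB12 : B1ᵀ * E8M * B2 = 0 := by decide
theorem hB21 : B2ᵀ * E8M * B1 = 0 := by decide
theorem hC11 : C1 * B1 = (5:ℤ) • 1 := by decide
theorem hC12 : C1 * B2 = 0 := by decide
theorem hC21 : C2 * B1 = 0 := by decide
theorem hC22 : C2 * B2 = (5:ℤ) • 1 := by decide
theorem hBC : B1 * C1 + B2 * C2 = (5:ℤ) • 1 := by decide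

theorem form_aux (P Q : Matrix (Fin 8) (Fin 4) ℤ) (x y : Fin 4 → ℤ) :
    (P *ᵥ x) ⬝ᵥ (E8M *ᵥ (Q *ᵥ y)) = x ⬝ᵥ ((Pᵀ * E8M * Q) *ᵥ y) := by
  rw [← Matrix.mulVec_mulVec, ← Matrix.mulVec_mulVec, Matrix.dotProduct_mulVec x,
    Matrix.vecMul_transpose]

/-- `M ⊕ M` embeds as a finite index sublattice of `E8(-1)`. -/
theorem stmt17 :
    ∃ ι : ((Fin 4 → ℤ) × (Fin 4 → ℤ)) →ₗ[ℤ] (Fin 8 → ℤ),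
      Function.Injective ι ∧
      (∀ p q : (Fin 4 → ℤ) × (Fin 4 → ℤ),
        bE8neg (ι p) (ι q) = bM5 p.1 q.1 + bM5 p.2 q.2) ∧
      (∃ k : ℤ, k ≠ 0 ∧ ∀ x : Fin 8 → ℤ, k • x ∈ LinearMap.range ι) := by
  have key : ∀ p : (Fin 4 → ℤ) × (Fin 4 → ℤ),
      (B1.mulVecLin.coprod B2.mulVecLin) p = B1 *ᵥ p.1 + B2 *ᵥ p.2 := fun p => by simp
  refine ⟨B1.mulVecLin.coprod B2.mulVecLin, ?_, ?_, 5, by norm_num, ?_⟩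
  · rw [injective_iff_map_eq_zero]
    intro p hp
    rw [key] at hp
    have h1 := congrArg (C1 *ᵥ ·) hp
    have h2 := congrArg (C2 *ᵥ ·) hp
    simp only [Matrix.mulVec_add, Matrix.mulVec_mulVec, hC11, hC12, hC21, hC22,
      Matrix.smul_mulVec, Matrix.one_mulVec, Matrix.zero_mulVec, Matrix.mulVec_zero,
      add_zero, zero_add] at h1 h2
    exact Prod.ext ((smul_eq_zero.mp h1).resolve_left (by norm_num))
      ((smul_eq_zero.mp h2).resolve_left (by norm_num))
  · intro p q
    rw [key, key]
    simp only [bE8neg, bM5, Matrix.mulVec_add, add_dotProduct, dotProduct_add, form_aux,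
      hB11, hB12, hB21, hB22, Matrix.neg_mulVec, Matrix.zero_mulVec, dotProduct_neg,
      dotProduct_zero]
    ring
  · intro x
    refine ⟨(C1 *ᵥ x, C2 *ᵥ x), ?_⟩
    rw [key]
    simp only [Matrix.mulVec_mulVec]
    rw [← Matrix.add_mulVec, hBC, Matrix.smul_mulVec, Matrix.one_mulVec]
end
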